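/- arXiv:2509.17558 — 5 statements merged into one kernel-verified Lean document; each statement's English description precedes it below -/
import Mathlib

section
/- Let W^H be a fractional Brownian motion with Hurst index H ∈ (0,1), h > 0, and let X^h be the associated nifBm. Then for all 0 ≤ t ≤ s, E[X_t^h X_s^h] = (1/(2h(2H+1)))·((s+h)^{2H+1} − s^{2H+1} + (t+h)^{2H+1} − t^{2H+1}) + (1/(2h²(2H+1)(2H+2)))·(2(s−t)^{2H+2} − (s−t+h)^{2H+2} − |s−t−h|^{2H+2}). In particular, for every t ≥ 0, E[(X_t^h)²] = (1/(h(2H+1)))·((t+h)^{2H+1} − t^{2H+1}) − h^{2H}/((2H+1)(2H+2)). -/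
open MeasureTheory ProbabilityTheory Filter Real Matrix Topology

noncomputable section

variable {Ω : Type*} [MeasurableSpace Ω]

/-- A (centered) fractional Brownian motion with Hurst index `H` on the probability space
`(Ω, P)`: a jointly measurable process with a.s. continuous sample paths, whose
finite-dimensional distributions are centered Gaussian (equivalently, every finite linear
combination of values of the process is a centered real Gaussian random variable), with
covariance `E[W_s W_t] = (s^{2H} + t^{2H} - |s-t|^{2H})/2` for `s, t ≥ 0`. -/
structure IsFBM (P : Measure Ω) (H : ℝ) (W : ℝ → Ω → ℝ) : Prop where
  jointMeasurable : Measurable (Function.uncurry W)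
  gaussian_fdd : ∀ (n : ℕ) (t : Fin n → ℝ), (∀ i, 0 ≤ t i) → ∀ c : Fin n → ℝ,
    ∃ v : NNReal, P.map (fun ω => ∑ i, c i * W (t i) ω) = gaussianReal 0 v
  cov : ∀ s t : ℝ, 0 ≤ s → 0 ≤ t →
    ∫ ω, W s ω * W t ω ∂P = (s ^ (2*H) + t ^ (2*H) - |s - t| ^ (2*H)) / 2
  cont : ∀ᵐ ω ∂P, Continuous fun t => W t ω

/-- The normalized integrated fractional Brownian motion (nifBm) with window `h`:
`X_t^{h,H} = (1/h) ∫_t^{t+h} W_u du`. -/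
def nifBm (W : ℝ → Ω → ℝ) (h t : ℝ) (ω : Ω) : ℝ := (1/h) * ∫ u in t..(t+h), W u ω

/-- The function `γ(H, n)`. -/
def gam (H : ℝ) (n : ℤ) : ℝ :=
  (|(n:ℝ) - 2| ^ (2*H+2) - 4 * |(n:ℝ) - 1| ^ (2*H+2) + 6 * |(n:ℝ)| ^ (2*H+2)
    - 4 * |(n:ℝ) + 1| ^ (2*H+2) + |(n:ℝ) + 2| ^ (2*H+2)) / (4 * (2*H+1) * (H+1))

/-- `log₊ x = log x` for `x > 0` and `0` otherwise. -/
def logpos (x : ℝ) : ℝ := if 0 < x then Real.log x else 0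

theorem hasDerivAt_mul_abs_rpow {a : ℝ} (ha : 0 < a) (x : ℝ) :
    HasDerivAt (fun y : ℝ => y * |y| ^ a / (a + 1)) (|x| ^ a) x := by
  have hcont : Continuous fun y : ℝ => |y| ^ a :=
    continuous_abs.rpow_const fun _ => Or.inr ha.le
  refine hasDerivAt_of_hasDerivAt_of_ne' (x := 0) (fun y hy => ?_)
    (((continuous_id.mul hcont).div_const _).continuousAt) hcont.continuousAt x
  have hy' : 0 < |y| := abs_pos.2 hy
  have hd := (((hasDerivAt_id y).mul
    ((hasDerivAt_abs hy).rpow_const (p := a) (Or.inl hy'.ne'))).div_const (a + 1))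
  refine hd.congr_deriv ?_
  have hs : y * (SignType.sign y : ℝ) = |y| := self_mul_sign y
  have hp : |y| * |y| ^ (a - 1) = |y| ^ a := by
    rw [Real.rpow_sub_one hy'.ne']; field_simp
  simp only [id]
  rw [div_eq_iff (by positivity)]
  linear_combination a * |y| ^ (a - 1) * hs + a * hp

theorem hasDerivAt_abs_rpow_add_two {a : ℝ} (ha : 0 < a) (x : ℝ) :
    HasDerivAt (fun y : ℝ => |y| ^ (a + 2) / ((a + 1) * (a + 2))) (x * |x| ^ a / (a + 1)) x := by
  refine ((hasDerivAt_abs_rpow x (p := a + 2) (by linarith)).div_const _).congr_deriv ?_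
  rw [add_sub_cancel_right]
  field_simp

theorem continuous_abs_sub_rpow {a : ℝ} (ha : 0 < a) :
    Continuous fun z : ℝ × ℝ => |z.1 - z.2| ^ a :=
  (continuous_fst.sub continuous_snd).abs.rpow_const fun _ => Or.inr ha.le

theorem integral_abs_sub_rpow {a : ℝ} (ha : 0 < a) (u c d : ℝ) :
    ∫ v in c..d, |u - v| ^ a
      = (u - c) * |u - c| ^ a / (a + 1) - (u - d) * |u - d| ^ a / (a + 1) := by
  have hcont : Continuous fun y : ℝ => |y| ^ a :=
    continuous_abs.rpow_const fun _ => Or.inr ha.le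
  rw [intervalIntegral.integral_comp_sub_left (fun x : ℝ => |x| ^ a) u,
    intervalIntegral.integral_eq_sub_of_hasDerivAt (fun x _ => hasDerivAt_mul_abs_rpow ha x)
      (hcont.intervalIntegrable _ _)]

theorem integral_integral_abs_sub_rpow {a : ℝ} (ha : 0 < a) (t₁ t₂ c d : ℝ) :
    ∫ u in t₁..t₂, ∫ v in c..d, |u - v| ^ a
      = (|t₂ - c| ^ (a + 2) - |t₁ - c| ^ (a + 2) - |t₂ - d| ^ (a + 2) + |t₁ - d| ^ (a + 2))
          / ((a + 1) * (a + 2)) := by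
  have hcont : Continuous fun y : ℝ => y * |y| ^ a / (a + 1) :=
    (continuous_id.mul (continuous_abs.rpow_const fun _ => Or.inr ha.le)).div_const _
  have key (r : ℝ) : ∫ u in t₁..t₂, (u - r) * |u - r| ^ a / (a + 1)
      = |t₂ - r| ^ (a + 2) / ((a + 1) * (a + 2)) - |t₁ - r| ^ (a + 2) / ((a + 1) * (a + 2)) := by
    rw [intervalIntegral.integral_comp_sub_right (fun x : ℝ => x * |x| ^ a / (a + 1)) r,
      intervalIntegral.integral_eq_sub_of_hasDerivAt
        (fun x _ => hasDerivAt_abs_rpow_add_two ha x) (hcont.intervalIntegrable _ _)]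
  have hsub (r : ℝ) : Continuous fun u : ℝ => (u - r) * |u - r| ^ a / (a + 1) :=
    hcont.comp (continuous_sub_right r)
  simp_rw [integral_abs_sub_rpow ha]
  rw [intervalIntegral.integral_sub ((hsub c).intervalIntegrable _ _)
    ((hsub d).intervalIntegrable _ _), key, key]
  ring

theorem integral_integral_fbm_cov {a : ℝ} (ha : 0 < a) (t₁ t₂ c d : ℝ) :
    ∫ u in t₁..t₂, ∫ v in c..d, (u ^ a + v ^ a - |u - v| ^ a) / 2
      = ((d - c) * (t₂ ^ (a + 1) - t₁ ^ (a + 1)) + (t₂ - t₁) * (d ^ (a + 1) - c ^ (a + 1)))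
          / (2 * (a + 1))
        - (|t₂ - c| ^ (a + 2) - |t₁ - c| ^ (a + 2) - |t₂ - d| ^ (a + 2) + |t₁ - d| ^ (a + 2))
          / (2 * (a + 1) * (a + 2)) := by
  have hpow (x y : ℝ) : ∫ u in x..y, u ^ a = (y ^ (a + 1) - x ^ (a + 1)) / (a + 1) :=
    integral_rpow (Or.inl (by linarith))
  have hc : Continuous fun y : ℝ => y ^ a := Real.continuous_rpow_const ha.le
  have habs (u : ℝ) : Continuous fun v : ℝ => |u - v| ^ a :=
    (continuous_abs_sub_rpow ha).comp (Continuous.prodMk_right u)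
  have hint : Continuous fun u : ℝ => ∫ v in c..d, |u - v| ^ a :=
    intervalIntegral.continuous_parametric_intervalIntegral_of_continuous'
      (continuous_abs_sub_rpow ha) c d
  have hadd (u : ℝ) : Continuous fun v : ℝ => u ^ a + v ^ a := continuous_const.add hc
  have hmul : Continuous fun u : ℝ => (d - c) * u ^ a := continuous_const.mul hc
  have hmul_add : Continuous fun u : ℝ =>
      (d - c) * u ^ a + (d ^ (a + 1) - c ^ (a + 1)) / (a + 1) := hmul.add continuous_const
  have inner (u : ℝ) : ∫ v in c..d, (u ^ a + v ^ a - |u - v| ^ a) / 2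
      = ((d - c) * u ^ a + (d ^ (a + 1) - c ^ (a + 1)) / (a + 1)
          - ∫ v in c..d, |u - v| ^ a) / 2 := by
    rw [intervalIntegral.integral_div, intervalIntegral.integral_sub
      ((hadd u).intervalIntegrable _ _) ((habs u).intervalIntegrable _ _),
      intervalIntegral.integral_add (continuous_const.intervalIntegrable _ _)
        (hc.intervalIntegrable _ _), intervalIntegral.integral_const, hpow, smul_eq_mul]
  simp_rw [inner]
  rw [intervalIntegral.integral_div, intervalIntegral.integral_sub
      (hmul_add.intervalIntegrable _ _)
      (hint.intervalIntegrable _ _),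
    intervalIntegral.integral_add (hmul.intervalIntegrable _ _)
      (continuous_const.intervalIntegrable _ _), intervalIntegral.integral_const_mul,
    intervalIntegral.integral_const, hpow, integral_integral_abs_sub_rpow ha, smul_eq_mul]
  field_simp

namespace IsFBM

variable {P : Measure Ω} {H : ℝ} {W : ℝ → Ω → ℝ}

theorem measurable_apply (hW : IsFBM P H W) (u : ℝ) : Measurable (W u) :=
  hW.jointMeasurable.comp measurable_prodMk_left

theorem memLp_two (hW : IsFBM P H W) {u : ℝ} (hu : 0 ≤ u) : MemLp (W u) 2 P := by
  obtain ⟨v, hv⟩ := hW.gaussian_fdd 1 (fun _ => u) (fun _ => hu) (fun _ => 1)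
  have hv' : P.map (W u) = gaussianReal 0 v := by simpa using hv
  have hid : MemLp id 2 (P.map (W u)) := hv' ▸ memLp_id_gaussianReal 2
  exact (memLp_map_measure_iff aestronglyMeasurable_id (hW.measurable_apply u).aemeasurable).1 hid

theorem integral_sq (hW : IsFBM P H W) (hH : 0 < H) {u : ℝ} (hu : 0 ≤ u) :
    ∫ ω, W u ω ^ 2 ∂P = u ^ (2 * H) := by
  have h0 : (0 : ℝ) ^ (2 * H) = 0 := Real.zero_rpow (by positivity)
  have := hW.cov u u hu hu
  simp only [sub_self, abs_zero, h0, ← sq] at this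
  rw [this]; ring

theorem integral_abs_mul_le (hW : IsFBM P H W) (hH : 0 < H) {u v : ℝ} (hu : 0 ≤ u) (hv : 0 ≤ v) :
    ∫ ω, |W u ω * W v ω| ∂P ≤ (u ^ (2 * H) + v ^ (2 * H)) / 2 := by
  rw [← hW.integral_sq hH hu, ← hW.integral_sq hH hv,
    ← integral_add (hW.memLp_two hu).integrable_sq (hW.memLp_two hv).integrable_sq,
    ← integral_div]
  refine integral_mono ((hW.memLp_two hu).integrable_mul (hW.memLp_two hv)).abs
    (((hW.memLp_two hu).integrable_sq.add (hW.memLp_two hv).integrable_sq).div_const 2)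
    fun ω => ?_
  simp only [abs_mul]
  nlinarith [sq_nonneg (|W u ω| - |W v ω|), sq_abs (W u ω), sq_abs (W v ω)]

theorem integrable_mul_prod [IsProbabilityMeasure P] (hW : IsFBM P H W) (hH : 0 < H)
    {a b c d : ℝ} (ha : 0 ≤ a) (hc : 0 ≤ c) :
    Integrable (fun p : Ω × ℝ × ℝ => W p.2.1 p.1 * W p.2.2 p.1)
      (P.prod ((volume.restrict (Set.Ioc a b)).prod (volume.restrict (Set.Ioc c d)))) := by
  have hmeas : Measurable fun p : Ω × ℝ × ℝ => W p.2.1 p.1 * W p.2.2 p.1 :=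
    (hW.jointMeasurable.comp (measurable_snd.fst.prodMk measurable_fst)).mul
      (hW.jointMeasurable.comp (measurable_snd.snd.prodMk measurable_fst))
  have hmem : ∀ᵐ z ∂((volume.restrict (Set.Ioc a b)).prod (volume.restrict (Set.Ioc c d))),
      z ∈ Set.Ioc a b ×ˢ Set.Ioc c d := by
    rw [Measure.prod_restrict]
    exact ae_restrict_mem (measurableSet_Ioc.prod measurableSet_Ioc)
  rw [integrable_prod_iff' hmeas.aestronglyMeasurable]
  constructor
  · filter_upwards [hmem] with z hz
    exact (hW.memLp_two (ha.trans hz.1.1.le)).integrable_mul (hW.memLp_two (hc.trans hz.2.1.le))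
  · refine Integrable.of_bound (C := (b ^ (2 * H) + d ^ (2 * H)) / 2)
      hmeas.norm.aestronglyMeasurable.prod_swap.integral_prod_right' ?_
    filter_upwards [hmem] with z hz
    have hz1 : 0 ≤ z.1 := ha.trans hz.1.1.le
    have hz2 : 0 ≤ z.2 := hc.trans hz.2.1.le
    rw [Real.norm_of_nonneg (integral_nonneg fun _ => norm_nonneg _)]
    refine (hW.integral_abs_mul_le hH hz1 hz2).trans ?_
    have := hz.1.2
    have := hz.2.2
    gcongr

theorem integral_mul_intervalIntegral [IsProbabilityMeasure P] (hW : IsFBM P H W) (hH : 0 < H)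
    {a b c d : ℝ} (ha : 0 ≤ a) (hab : a ≤ b) (hc : 0 ≤ c) (hcd : c ≤ d) :
    ∫ ω, (∫ u in a..b, W u ω) * (∫ v in c..d, W v ω) ∂P
      = ∫ u in a..b, ∫ v in c..d, (u ^ (2 * H) + v ^ (2 * H) - |u - v| ^ (2 * H)) / 2 := by
  have hint := hW.integrable_mul_prod hH (b := b) (d := d) ha hc
  simp only [intervalIntegral.integral_of_le hab, intervalIntegral.integral_of_le hcd]
  simp_rw [← integral_prod_mul]
  rw [integral_integral_swap (f := fun ω (z : ℝ × ℝ) => W z.1 ω * W z.2 ω) hint,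
    integral_prod _ hint.integral_prod_right]
  refine setIntegral_congr_fun measurableSet_Ioc fun u hu =>
    setIntegral_congr_fun measurableSet_Ioc fun v hv => ?_
  exact hW.cov u v (ha.trans hu.1.le) (hc.trans hv.1.le)

end IsFBM

/-- Covariance of the nifBm: for `0 ≤ t ≤ s`,
`E[X_t^h X_s^h]` is given by the explicit formula, and in particular
`E[(X_t^h)²] = ((t+h)^{2H+1} - t^{2H+1})/(h(2H+1)) - h^{2H}/((2H+1)(2H+2))` for all `t ≥ 0`. -/
theorem nifBm_covariance
    (P : Measure Ω) [IsProbabilityMeasure P] (H : ℝ) (hH : H ∈ Set.Ioo (0:ℝ) 1)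
    (W : ℝ → Ω → ℝ) (hW : IsFBM P H W) (h : ℝ) (hh : 0 < h) :
    (∀ t s : ℝ, 0 ≤ t → t ≤ s →
      ∫ ω, nifBm W h t ω * nifBm W h s ω ∂P
        = ((s+h) ^ (2*H+1) - s ^ (2*H+1) + (t+h) ^ (2*H+1) - t ^ (2*H+1))
            / (2*h*(2*H+1))
          + (2*(s-t) ^ (2*H+2) - (s-t+h) ^ (2*H+2) - |s-t-h| ^ (2*H+2))
            / (2*h^2*(2*H+1)*(2*H+2))) ∧
    (∀ t : ℝ, 0 ≤ t →
      ∫ ω, (nifBm W h t ω)^2 ∂P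
        = ((t+h) ^ (2*H+1) - t ^ (2*H+1)) / (h*(2*H+1))
          - h ^ (2*H) / ((2*H+1)*(2*H+2))) := by
  have ha : 0 < 2 * H := by linarith [hH.1]
  have cov : ∀ t s : ℝ, 0 ≤ t → t ≤ s →
      ∫ ω, nifBm W h t ω * nifBm W h s ω ∂P
        = ((s+h) ^ (2*H+1) - s ^ (2*H+1) + (t+h) ^ (2*H+1) - t ^ (2*H+1))
            / (2*h*(2*H+1))
          + (2*(s-t) ^ (2*H+2) - (s-t+h) ^ (2*H+2) - |s-t-h| ^ (2*H+2))
            / (2*h^2*(2*H+1)*(2*H+2)) := by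
    intro t s ht hts
    have e (ω : Ω) : nifBm W h t ω * nifBm W h s ω = (1 / h) ^ 2 *
        ((∫ u in t..(t+h), W u ω) * ∫ v in s..(s+h), W v ω) := by
      unfold nifBm; ring
    simp_rw [e]
    rw [integral_const_mul, hW.integral_mul_intervalIntegral hH.1 ht (by linarith)
      (ht.trans hts) (by linarith), integral_integral_fbm_cov ha]
    have e1 : |t + h - s| = |s - t - h| := by rw [← abs_neg]; congr 1; ring
    have e2 : |t - s| = s - t := by rw [abs_sub_comm, abs_of_nonneg (by linarith)]
    have e3 : |t + h - (s + h)| = s - t := by rw [add_sub_add_right_eq_sub, e2]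
    have e4 : |t - (s + h)| = s - t + h := by
      rw [abs_sub_comm, abs_of_nonneg (by linarith)]; ring
    rw [e1, e2, e3, e4]
    field_simp
    ring
  refine ⟨cov, fun t ht => ?_⟩
  have h0 : (0 : ℝ) ^ (2*H+2) = 0 := Real.zero_rpow (by positivity)
  have hp : h ^ (2*H+2) = h ^ (2*H) * h ^ 2 := by
    rw [Real.rpow_add hh, Real.rpow_two]
  simp_rw [sq (nifBm W h t _)]
  rw [cov t t ht le_rfl, sub_self, h0, zero_add, zero_sub, abs_neg, abs_of_pos hh, hp]
  field_simp
  ring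
end
end

section
/- There exists a unique H₀ ∈ (0,1) such that γ(H₀,1) = 0; moreover γ(H,1) < 0 for all H ∈ (0,H₀) and γ(H,1) > 0 for all H ∈ (H₀,1]. (Numerically H₀ ≈ 0.2626229; equivalently, the function H ↦ 7 − 2^{2H+4} + 3^{2H+2} has a unique zero H₀ in (0,1), is negative on (0,H₀) and positive on (H₀,1].) -/
open MeasureTheory ProbabilityTheory Filter Real Matrix Topology

noncomputable section

variable {Ω : Type*} [MeasurableSpace Ω]

lemma gam_one_eq (H : ℝ) (hH : 0 ≤ H) :
    gam H 1 = (7 - 16 * exp (log 4 * H) + 9 * exp (log 9 * H)) / (4 * (2*H+1) * (H+1)) := by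
  have h2 : (2:ℝ) ^ (2*H+2) = 4 * exp (log 4 * H) := by
    rw [rpow_add two_pos, rpow_mul two_pos.le, ← rpow_def_of_pos (by norm_num : (0:ℝ) < 4)]
    norm_num
    ring
  have h3 : (3:ℝ) ^ (2*H+2) = 9 * exp (log 9 * H) := by
    rw [rpow_add three_pos, rpow_mul three_pos.le, ← rpow_def_of_pos (by norm_num : (0:ℝ) < 9)]
    norm_num
    ring
  have h0 : (0:ℝ) ^ (2*H+2) = 0 := zero_rpow (by positivity)
  unfold gam
  norm_num
  rw [h0, h2, h3]
  ring

lemma strictConvexOn_gam_one_numerator :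
    StrictConvexOn ℝ (Set.Icc 0 1)
      fun H : ℝ => 7 - 16 * exp (log 4 * H) + 9 * exp (log 9 * H) := by
  have hexp (c x : ℝ) : HasDerivAt (fun H => exp (c * H)) (exp (c * x) * c) x := by
    simpa using ((hasDerivAt_id x).const_mul c).exp
  have hderiv : deriv (fun H : ℝ => 7 - 16 * exp (log 4 * H) + 9 * exp (log 9 * H)) =
      fun H => -(16 * (exp (log 4 * H) * log 4)) + 9 * (exp (log 9 * H) * log 9) := by
    funext x
    exact ((((hexp (log 4) x).const_mul 16).const_sub 7).add
      ((hexp (log 9) x).const_mul 9)).deriv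
  refine strictConvexOn_of_deriv2_pos (convex_Icc 0 1) (by fun_prop) fun x hx => ?_
  rw [interior_Icc] at hx
  have hderiv2 : deriv
      (fun H => -(16 * (exp (log 4 * H) * log 4)) + 9 * (exp (log 9 * H) * log 9)) x =
      -(16 * (exp (log 4 * x) * log 4 * log 4)) + 9 * (exp (log 9 * x) * log 9 * log 9) :=
    (((((hexp (log 4) x).mul_const (log 4)).const_mul 16).neg).add
      (((hexp (log 9) x).mul_const (log 9)).const_mul 9)).deriv
  rw [Function.iterate_succ, Function.iterate_one, Function.comp_apply, hderiv, hderiv2]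
  have hlog4 : 0 < log 4 := log_pos (by norm_num)
  have hlog : 4 * log 4 < 3 * log 9 := by
    have := log_lt_log (by norm_num) (by norm_num : (4:ℝ) ^ 4 < 9 ^ 3)
    rwa [log_pow, log_pow] at this
  have hsq : 16 * log 4 ^ 2 < 9 * log 9 ^ 2 := by nlinarith
  have hmono : exp (log 4 * x) ≤ exp (log 9 * x) := by
    have := hx.1.le
    gcongr
    norm_num
  have hpos := exp_pos (log 4 * x)
  nlinarith [mul_lt_mul_of_pos_right hsq hpos,
    mul_le_mul_of_nonneg_left hmono (by positivity : 0 ≤ 9 * log 9 ^ 2)]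

lemma gam_one_numerator_quarter_neg :
    7 - 16 * exp (log 4 * (1/4)) + 9 * exp (log 9 * (1/4)) < 0 := by
  have h4 : exp (log 4 * (1/4)) = √2 := by
    rw [← rpow_def_of_pos (by norm_num), sqrt_eq_rpow,
      show (4:ℝ) = 2 ^ (2:ℝ) by norm_num, ← rpow_mul two_pos.le]
    norm_num
  have h9 : exp (log 9 * (1/4)) = √3 := by
    rw [← rpow_def_of_pos (by norm_num), sqrt_eq_rpow,
      show (9:ℝ) = 3 ^ (2:ℝ) by norm_num, ← rpow_mul three_pos.le]
    norm_num
  rw [h4, h9]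
  have h2 : 1.414 < √2 := lt_sqrt_of_sq_lt (by norm_num)
  have h3 : √3 < 1.7325 := (sqrt_lt' (by norm_num)).2 (by norm_num)
  linarith

/-- There exists a unique `H₀ ∈ (0,1)` with `γ(H₀,1) = 0`; moreover
`γ(H,1) < 0` on `(0,H₀)` and `γ(H,1) > 0` on `(H₀,1]`. -/
theorem gamma_one_sign_change :
    ∃ H₀ ∈ Set.Ioo (0:ℝ) 1, gam H₀ 1 = 0 ∧
      (∀ H ∈ Set.Ioo (0:ℝ) H₀, gam H 1 < 0) ∧
      (∀ H ∈ Set.Ioc H₀ (1:ℝ), 0 < gam H 1) ∧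
      (∀ H ∈ Set.Ioo (0:ℝ) 1, gam H 1 = 0 → H = H₀) := by
  set F : ℝ → ℝ := fun H => 7 - 16 * exp (log 4 * H) + 9 * exp (log 9 * H) with hF
  have hconv : StrictConvexOn ℝ (Set.Icc 0 1) F := strictConvexOn_gam_one_numerator
  have hgam {H : ℝ} (hH : 0 ≤ H) : gam H 1 = F H / (4 * (2*H+1) * (H+1)) := gam_one_eq H hH
  have hF0 : F 0 = 0 := by norm_num [hF]
  have hF1 : 0 < F 1 := by norm_num [hF, exp_log]
  obtain ⟨H₀, ⟨hlow, hup⟩, hzero⟩ : ∃ H₀ ∈ Set.Ioo (1/4 : ℝ) 1, F H₀ = 0 :=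
    intermediate_value_Ioo (by norm_num) (by fun_prop)
      ⟨gam_one_numerator_quarter_neg, hF1⟩
  have hpos : 0 < H₀ := by linarith
  have hneg : ∀ H ∈ Set.Ioo (0:ℝ) H₀, gam H 1 < 0 := by
    rintro H ⟨h0, h1⟩
    have h := hconv.lt_on_openSegment (x := 0) (y := H₀) (by simp) ⟨hpos.le, hup.le⟩ hpos.ne
      (by rw [openSegment_eq_Ioo hpos]; exact ⟨h0, h1⟩)
    rw [hF0, hzero, max_self] at h
    rw [hgam h0.le]
    exact div_neg_of_neg_of_pos h (by positivity)
  have hposv : ∀ H ∈ Set.Ioc H₀ (1:ℝ), 0 < gam H 1 := by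
    rintro H ⟨h0, h1⟩
    have hH : 0 < H := hpos.trans h0
    have h := hconv.lt_on_openSegment (x := 0) (y := H) (by simp) ⟨hH.le, h1⟩ hH.ne
      (by rw [openSegment_eq_Ioo hH]; exact ⟨hpos, h0⟩)
    rw [hF0, hzero, lt_max_iff] at h
    rw [hgam hH.le]
    exact div_pos (h.resolve_left (lt_irrefl 0)) (by positivity)
  refine ⟨H₀, ⟨hpos, hup⟩, by rw [hgam hpos.le, hzero, zero_div], hneg, hposv, ?_⟩
  rintro H ⟨h0, h1⟩ hz
  rcases lt_trichotomy H H₀ with h | h | h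
  · exact absurd hz (hneg H ⟨h0, h⟩).ne
  · exact h
  · exact absurd hz (hposv H ⟨h, h1.le⟩).ne'
end
end

section
/- For every integer n ≥ 2, the function H ↦ γ(H,n) on (0,1) satisfies: γ(H,n) < 0 for all H ∈ (0,1/2), γ(1/2,n) = 0, and γ(H,n) > 0 for all H ∈ (1/2,1). -/
open MeasureTheory ProbabilityTheory Filter Real Matrix Topology

noncomputable section

variable {Ω : Type*} [MeasurableSpace Ω]

/-- The second central difference of `x ↦ x ^ p`. -/
def rpowDiff (p x : ℝ) : ℝ := (x + 1) ^ p - 2 * x ^ p + (x - 1) ^ p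

lemma hasDerivAt_rpowDiff {p : ℝ} (hp : 1 ≤ p) (x : ℝ) :
    HasDerivAt (rpowDiff p) (p * rpowDiff (p - 1) x) x := by
  have h1 := ((hasDerivAt_id x).add_const (1 : ℝ)).rpow_const (p := p) (Or.inr hp)
  have h2 := ((hasDerivAt_id x).rpow_const (p := p) (Or.inr hp)).const_mul (2 : ℝ)
  have h3 := ((hasDerivAt_id x).sub_const (1 : ℝ)).rpow_const (p := p) (Or.inr hp)
  refine ((h1.sub h2).add h3).congr_deriv ?_
  simp only [rpowDiff, id]
  ring

lemma iterate_deriv_two_rpowDiff {p : ℝ} (hp : 2 ≤ p) (x : ℝ) :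
    deriv^[2] (rpowDiff p) x = p * ((p - 1) * rpowDiff (p - 2) x) := by
  have h : deriv (rpowDiff p) = fun y => p * rpowDiff (p - 1) y :=
    funext fun y => (hasDerivAt_rpowDiff (by linarith) y).deriv
  have h' := ((hasDerivAt_rpowDiff (p := p - 1) (by linarith) x).const_mul p).deriv
  rw [show p - 1 - 1 = p - 2 by ring] at h'
  simpa only [Function.iterate_succ, Function.iterate_zero, Function.comp_apply, id, h] using h'

lemma StrictConvexOn.central_diff_pos {s : Set ℝ} {f : ℝ → ℝ} (hf : StrictConvexOn ℝ s f) {x : ℝ}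
    (h₁ : x - 1 ∈ s) (h₂ : x + 1 ∈ s) : 0 < f (x + 1) - 2 * f x + f (x - 1) := by
  have h := hf.2 h₁ h₂ (by linarith : x - 1 < x + 1).ne
    (by norm_num : (0 : ℝ) < 1 / 2) (by norm_num : (0 : ℝ) < 1 / 2) (by norm_num)
  simp only [smul_eq_mul] at h
  rw [show 1 / 2 * (x - 1) + 1 / 2 * (x + 1) = x by ring] at h
  linarith

lemma StrictConcaveOn.central_diff_neg {s : Set ℝ} {f : ℝ → ℝ} (hf : StrictConcaveOn ℝ s f)
    {x : ℝ} (h₁ : x - 1 ∈ s) (h₂ : x + 1 ∈ s) : f (x + 1) - 2 * f x + f (x - 1) < 0 := by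
  have h := hf.neg.central_diff_pos h₁ h₂
  simp only [Pi.neg_apply] at h
  linarith

lemma continuous_rpowDiff {p : ℝ} (hp : 1 ≤ p) : Continuous (rpowDiff p) :=
  continuous_iff_continuousAt.2 fun x => (hasDerivAt_rpowDiff hp x).continuousAt

lemma strictConvexOn_rpowDiff {p : ℝ} (hp : 3 < p) :
    StrictConvexOn ℝ (Set.Ici 1) (rpowDiff p) := by
  refine strictConvexOn_of_deriv2_pos (convex_Ici 1)
    (continuous_rpowDiff (by linarith)).continuousOn fun x hx => ?_
  rw [interior_Ici, Set.mem_Ioi] at hx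
  rw [iterate_deriv_two_rpowDiff (by linarith)]
  have h := (strictConvexOn_rpow (p := p - 2) (by linarith)).central_diff_pos (x := x)
    (Set.mem_Ici.2 (by linarith)) (Set.mem_Ici.2 (by linarith))
  exact mul_pos (by linarith) (mul_pos (by linarith) h)

lemma strictConcaveOn_rpowDiff {p : ℝ} (hp₂ : 2 < p) (hp₃ : p < 3) :
    StrictConcaveOn ℝ (Set.Ici 1) (rpowDiff p) := by
  refine strictConcaveOn_of_deriv2_neg (convex_Ici 1)
    (continuous_rpowDiff (by linarith)).continuousOn fun x hx => ?_
  rw [interior_Ici, Set.mem_Ioi] at hx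
  rw [iterate_deriv_two_rpowDiff hp₂.le]
  have h := (strictConcaveOn_rpow (p := p - 2) (by linarith) (by linarith)).central_diff_neg
    (x := x) (Set.mem_Ici.2 (by linarith)) (Set.mem_Ici.2 (by linarith))
  exact mul_neg_of_pos_of_neg (by linarith) (mul_neg_of_pos_of_neg (by linarith) h)

lemma gam_eq_rpowDiff (H : ℝ) {n : ℤ} (hn : 2 ≤ n) :
    gam H n = (rpowDiff (2 * H + 2) (n + 1) - 2 * rpowDiff (2 * H + 2) n
      + rpowDiff (2 * H + 2) (n - 1)) / (4 * (2 * H + 1) * (H + 1)) := by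
  have hn' : (2 : ℝ) ≤ n := by exact_mod_cast hn
  rw [gam, abs_of_nonneg (by linarith : (0 : ℝ) ≤ n - 2),
    abs_of_nonneg (by linarith : (0 : ℝ) ≤ n - 1), abs_of_nonneg (by linarith : (0 : ℝ) ≤ n),
    abs_of_nonneg (by linarith : (0 : ℝ) ≤ n + 1), abs_of_nonneg (by linarith : (0 : ℝ) ≤ n + 2)]
  simp only [rpowDiff]
  rw [show (n : ℝ) + 1 + 1 = n + 2 by ring, show (n : ℝ) - 1 - 1 = n - 2 by ring,
    add_sub_cancel_right, sub_add_cancel]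
  ring

/-- For every integer `n ≥ 2`, `γ(·,n)` is negative on `(0,1/2)`, vanishes
at `H = 1/2` and is positive on `(1/2,1)`. -/
theorem gamma_sign_nonoverlapping (n : ℤ) (hn : 2 ≤ n) :
    (∀ H ∈ Set.Ioo (0:ℝ) (1/2), gam H n < 0) ∧
    gam (1/2) n = 0 ∧
    (∀ H ∈ Set.Ioo (1/2 : ℝ) 1, 0 < gam H n) := by
  have hn' : (2 : ℝ) ≤ n := by exact_mod_cast hn
  have h₁ : (n : ℝ) - 1 ∈ Set.Ici (1 : ℝ) := Set.mem_Ici.2 (by linarith)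
  have h₂ : (n : ℝ) + 1 ∈ Set.Ici (1 : ℝ) := Set.mem_Ici.2 (by linarith)
  refine ⟨fun H ⟨hH₀, hH₁⟩ => ?_, ?_, fun H ⟨hH₀, _⟩ => ?_⟩
  · rw [gam_eq_rpowDiff H hn]
    exact div_neg_of_neg_of_pos ((strictConcaveOn_rpowDiff (by linarith)
      (by linarith)).central_diff_neg h₁ h₂) (by positivity)
  · rw [gam_eq_rpowDiff _ hn, show (2 * (1 / 2) + 2 : ℝ) = (3 : ℕ) by norm_num]
    simp only [rpowDiff, Real.rpow_natCast]
    ring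
  · rw [gam_eq_rpowDiff H hn]
    have hH : 0 < H := by linarith
    exact div_pos ((strictConvexOn_rpowDiff (by linarith)).central_diff_pos h₁ h₂)
      (by positivity)
end
end

section
/- Fix H ∈ (0,1) and h > 0. For every n ≥ 1 and all integers 0 ≤ k₁ < k₂ < … < k_n, the n×n covariance matrix Σ_{k₁,…,k_n} with entries (Σ)_{ij} = Cov(ΔX^h_{k_i}, ΔX^h_{k_j}) = h^{2H} γ(H, |k_i − k_j|) has rank n, i.e., it is nonsingular. Equivalently, the n×n matrix with entries γ(H, |k_i − k_j|) is invertible. -/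
open MeasureTheory ProbabilityTheory Filter Real Matrix Topology

noncomputable section

variable {Ω : Type*} [MeasurableSpace Ω]

/-- The integrand of the spectral representation of `|x| ^ p` for `2 < p < 4`. -/
def powKernel (p x l : ℝ) : ℝ := (cos (l * x) - 1 + (l * x) ^ 2 / 2) * l ^ (-p - 1)

lemma powKernel_one_nonneg (p : ℝ) {l : ℝ} (hl : 0 < l) : 0 ≤ powKernel p 1 l := by
  have := Real.one_sub_sq_div_two_le_cos (x := l * 1)
  exact mul_nonneg (by linarith) (rpow_nonneg hl.le _)

lemma continuousOn_powKernel (p x : ℝ) : ContinuousOn (powKernel p x) (Set.Ioi 0) := by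
  unfold powKernel
  refine ContinuousOn.mul (by fun_prop) ?_
  exact continuousOn_id.rpow_const fun l hl => Or.inl (ne_of_gt hl)

lemma integrableOn_powKernel_one {p : ℝ} (h2 : 2 < p) (h4 : p < 4) :
    IntegrableOn (powKernel p 1) (Set.Ioi 0) := by
  rw [← Set.Ioc_union_Ioi_eq_Ioi zero_le_one]
  refine IntegrableOn.union ?_ ?_
  · have hg : IntegrableOn (fun l : ℝ => l ^ (3 - p)) (Set.Ioc 0 1) :=
      (intervalIntegrable_iff_integrableOn_Ioc_of_le zero_le_one).1
        (intervalIntegral.intervalIntegrable_rpow' (by linarith))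
    refine Integrable.mono' hg
      (((continuousOn_powKernel p 1).mono Set.Ioc_subset_Ioi_self).aestronglyMeasurable
        measurableSet_Ioc) ?_
    refine (ae_restrict_iff' measurableSet_Ioc).2 (ae_of_all _ fun l hl => ?_)
    rw [Real.norm_of_nonneg (powKernel_one_nonneg p hl.1)]
    have hb := (abs_le.1 (Real.cos_bound (x := l) (by rw [abs_of_pos hl.1]; exact hl.2))).2
    rw [abs_of_pos hl.1] at hb
    have hpow : l ^ (3 - p) = l ^ 4 * l ^ (-p - 1) := by
      rw [← Real.rpow_natCast, ← Real.rpow_add hl.1]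
      congr 1
      push_cast
      ring
    rw [hpow, powKernel, mul_one]
    have h0 : 0 ≤ l ^ 4 := pow_nonneg hl.1.le 4
    exact mul_le_mul_of_nonneg_right (by linarith) (rpow_nonneg hl.1.le _)
  · refine Integrable.mono' (integrableOn_Ioi_rpow_of_lt (a := 1 - p) (by linarith) one_pos)
      (((continuousOn_powKernel p 1).mono
        (Set.Ioi_subset_Ioi zero_le_one)).aestronglyMeasurable measurableSet_Ioi) ?_
    refine (ae_restrict_iff' measurableSet_Ioi).2 (ae_of_all _ fun l hl => ?_)
    have hl0 : 0 < l := one_pos.trans hl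
    rw [Real.norm_of_nonneg (powKernel_one_nonneg p hl0)]
    have hpow : l ^ (1 - p) = l ^ 2 * l ^ (-p - 1) := by
      rw [← Real.rpow_natCast, ← Real.rpow_add hl0]
      congr 1
      push_cast
      ring
    rw [hpow, powKernel, mul_one]
    have h0 := Real.cos_le_one l
    have h1 := sq_nonneg l
    exact mul_le_mul_of_nonneg_right (by linarith) (rpow_nonneg hl0.le _)

lemma integral_powKernel_one_pos {p : ℝ} (h2 : 2 < p) (h4 : p < 4) :
    0 < ∫ l in Set.Ioi 0, powKernel p 1 l := by
  rw [setIntegral_pos_iff_support_of_nonneg_ae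
    ((ae_restrict_iff' measurableSet_Ioi).2 (ae_of_all _ fun l hl => powKernel_one_nonneg p hl))
    (integrableOn_powKernel_one h2 h4)]
  refine lt_of_lt_of_le (b := volume (Set.Ioi (0 : ℝ))) (by simp) (measure_mono fun l hl => ?_)
  have hl0 : (0 : ℝ) < l := hl
  have := Real.one_sub_sq_div_two_lt_cos hl0.ne'
  exact ⟨(mul_pos (by rw [mul_one]; linarith) (rpow_pos_of_pos hl0 _)).ne', hl⟩

lemma powKernel_abs (p x l : ℝ) : powKernel p |x| l = powKernel p x l := by
  rcases abs_choice x with h | h <;> simp [powKernel, h]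

lemma powKernel_scale (p : ℝ) {x l : ℝ} (hx : 0 < x) (hl : 0 < l) :
    powKernel p x l = x ^ (p + 1) * powKernel p 1 (x * l) := by
  have : x ^ (p + 1) * x ^ (-p - 1) = 1 := by
    rw [← Real.rpow_add hx, show p + 1 + (-p - 1) = 0 by ring, Real.rpow_zero]
  simp only [powKernel, mul_one, Real.mul_rpow hx.le hl.le, mul_comm l x]
  linear_combination (-(cos (x * l) - 1 + (x * l) ^ 2 / 2) * l ^ (-p - 1)) * this

lemma integrableOn_powKernel {p : ℝ} (h2 : 2 < p) (h4 : p < 4) (x : ℝ) :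
    IntegrableOn (powKernel p x) (Set.Ioi 0) := by
  rcases eq_or_ne x 0 with rfl | hx
  · exact integrableOn_zero.congr_fun (fun l _ => by simp [powKernel]) measurableSet_Ioi
  have hx' : 0 < |x| := abs_pos.2 hx
  have hi := (integrableOn_Ioi_comp_mul_left_iff (powKernel p 1) 0 hx').2
    (by rw [mul_zero]; exact integrableOn_powKernel_one h2 h4)
  refine IntegrableOn.congr_fun (hi.const_mul (|x| ^ (p + 1))) (fun l hl => ?_) measurableSet_Ioi
  rw [← powKernel_abs p x, powKernel_scale p hx' hl]

/-- Spectral representation of `|x| ^ p` for `2 < p < 4`, up to a constant. -/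
lemma integral_powKernel {p : ℝ} (h2 : 2 < p) (x : ℝ) :
    ∫ l in Set.Ioi 0, powKernel p x l = |x| ^ p * ∫ l in Set.Ioi 0, powKernel p 1 l := by
  rcases eq_or_ne x 0 with rfl | hx
  · simp [powKernel, Real.zero_rpow (by linarith : p ≠ 0)]
  have hx' : 0 < |x| := abs_pos.2 hx
  have hs : ∫ l in Set.Ioi 0, powKernel p x l
      = ∫ l in Set.Ioi 0, |x| ^ (p + 1) * powKernel p 1 (|x| * l) :=
    setIntegral_congr_fun measurableSet_Ioi fun l hl => by
      rw [← powKernel_abs p x, powKernel_scale p hx' hl]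
  rw [hs, integral_const_mul, integral_comp_mul_left_Ioi _ 0 hx', mul_zero, smul_eq_mul,
    Real.rpow_add_one hx'.ne']
  field_simp

/-- The spectral density of the fourth difference of `|x| ^ p`, up to a constant. -/
def spectralDensity (p l : ℝ) : ℝ := (2 - 2 * cos l) ^ 2 * l ^ (-p - 1)

lemma powKernel_fourth_difference (p x l : ℝ) :
    powKernel p (x - 2) l - 4 * powKernel p (x - 1) l + 6 * powKernel p x l
      - 4 * powKernel p (x + 1) l + powKernel p (x + 2) l
      = spectralDensity p l * cos (x * l) := by
  simp only [powKernel, spectralDensity, mul_sub, mul_add, Real.cos_sub, Real.cos_add, mul_one,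
    mul_comm l 2, Real.cos_two_mul, mul_comm l x]
  ring

lemma integrableOn_spectralDensity_mul_cos {p : ℝ} (h2 : 2 < p) (h4 : p < 4) (x : ℝ) :
    IntegrableOn (fun l => spectralDensity p l * cos (x * l)) (Set.Ioi 0) := by
  have hi := integrableOn_powKernel h2 h4
  simp_rw [← powKernel_fourth_difference]
  exact ((((hi (x - 2)).sub ((hi (x - 1)).const_mul 4)).add ((hi x).const_mul 6)).sub
    ((hi (x + 1)).const_mul 4)).add (hi (x + 2))

lemma integral_spectralDensity_mul_cos {p : ℝ} (h2 : 2 < p) (h4 : p < 4) (x : ℝ) :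
    ∫ l in Set.Ioi 0, spectralDensity p l * cos (x * l)
      = (|x - 2| ^ p - 4 * |x - 1| ^ p + 6 * |x| ^ p - 4 * |x + 1| ^ p + |x + 2| ^ p)
        * ∫ l in Set.Ioi 0, powKernel p 1 l := by
  have hi := integrableOn_powKernel h2 h4
  have i1 := (hi (x - 2)).sub ((hi (x - 1)).const_mul 4)
  have i2 := i1.add ((hi x).const_mul 6)
  have i3 := i2.sub ((hi (x + 1)).const_mul 4)
  simp_rw [← powKernel_fourth_difference]
  refine (integral_add i3 (hi _)).trans ?_
  rw [integral_sub' i2 ((hi _).const_mul 4), integral_add' i1 ((hi _).const_mul 6),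
    integral_sub' (hi _) ((hi _).const_mul 4)]
  simp only [integral_const_mul]
  rw [integral_powKernel h2 (x - 2), integral_powKernel h2 (x - 1), integral_powKernel h2 x,
    integral_powKernel h2 (x + 1), integral_powKernel h2 (x + 2)]
  ring

lemma sum_sum_mul_cos_sub {ι : Type*} [Fintype ι] (c t : ι → ℝ) :
    ∑ i, ∑ j, c i * c j * cos (t i - t j)
      = (∑ i, c i * cos (t i)) ^ 2 + (∑ i, c i * sin (t i)) ^ 2 := by
  simp only [sq, Finset.sum_mul_sum, ← Finset.sum_add_distrib, Real.cos_sub]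
  refine Finset.sum_congr rfl fun i _ => Finset.sum_congr rfl fun j _ => ?_
  ring

/-- A nonzero trigonometric polynomial has finitely many zeros in `(0, 1)`. -/
lemma finite_zeros_trigPoly {ι : Type*} [Fintype ι] {k : ι → ℕ} (hk : Function.Injective k)
    {c : ι → ℝ} (hc : c ≠ 0) :
    {l ∈ Set.Ioo (0 : ℝ) 1 |
      (∑ i, c i * cos (k i * l)) ^ 2 + (∑ i, c i * sin (k i * l)) ^ 2 = 0}.Finite := by
  classical
  let q : Polynomial ℂ := ∑ i, Polynomial.monomial (k i) (c i : ℂ)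
  have hq : q ≠ 0 := by
    obtain ⟨i, hi⟩ := Function.ne_iff.1 hc
    intro h0
    have := congrArg (fun r => Polynomial.coeff r (k i)) h0
    simp only [q, Polynomial.finsetSum_coeff, Polynomial.coeff_monomial, hk.eq_iff,
      Finset.sum_ite_eq', Finset.mem_univ, if_true, Polynomial.coeff_zero] at this
    exact hi (by exact_mod_cast this)
  refine Set.Finite.of_finite_image (f := fun l : ℝ => Complex.exp (l * Complex.I))
    ((Polynomial.finite_setOfPred_isRoot hq).subset ?_) ?_
  · rintro _ ⟨l, ⟨-, hl⟩, rfl⟩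
    have hre : ∑ i, c i * cos (k i * l) = 0 := by nlinarith
    have him : ∑ i, c i * sin (k i * l) = 0 := by nlinarith
    have he : q.eval (Complex.exp (l * Complex.I))
        = ((∑ i, c i * cos (k i * l) : ℝ) : ℂ)
          + ((∑ i, c i * sin (k i * l) : ℝ) : ℂ) * Complex.I := by
      push_cast
      rw [Polynomial.eval_finsetSum, Finset.sum_mul, ← Finset.sum_add_distrib]
      refine Finset.sum_congr rfl fun i _ => ?_
      rw [Polynomial.eval_monomial, ← Complex.exp_nat_mul, ← mul_assoc, Complex.exp_mul_I]
      ring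
    change q.eval _ = 0
    rw [he, hre, him]
    simp
  · intro a ha b hb hab
    have := congrArg Complex.re hab
    simp only [Complex.exp_ofReal_mul_I_re] at this
    have hpi := Real.pi_gt_three
    exact Real.injOn_cos ⟨ha.1.1.le, by linarith [ha.1.2]⟩ ⟨hb.1.1.le, by linarith [hb.1.2]⟩ this

lemma spectralDensity_nonneg (p : ℝ) {l : ℝ} (hl : 0 < l) : 0 ≤ spectralDensity p l :=
  mul_nonneg (sq_nonneg _) (rpow_nonneg hl.le _)

lemma spectralDensity_pos (p : ℝ) {l : ℝ} (hl : l ∈ Set.Ioo (0 : ℝ) 1) :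
    0 < spectralDensity p l := by
  have hcos : cos l < 1 := by
    have := Real.cos_lt_cos_of_nonneg_of_le_pi le_rfl
      (by linarith [Real.pi_gt_three, hl.2]) hl.1
    rwa [Real.cos_zero] at this
  exact mul_pos (pow_pos (by linarith) 2) (rpow_pos_of_pos hl.1 _)

/-- The quadratic form of the fourth difference of `|x| ^ p` is positive definite on distinct
integers. -/
lemma quadratic_form_fourth_difference_pos {ι : Type*} [Fintype ι] {p : ℝ} (h2 : 2 < p)
    (h4 : p < 4) {k : ι → ℕ} (hk : Function.Injective k) {c : ι → ℝ} (hc : c ≠ 0) :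
    0 < ∑ i, ∑ j, c i * c j *
      ∫ l in Set.Ioi 0, spectralDensity p l * cos (((k i : ℝ) - k j) * l) := by
  have hi (i j : ι) := (integrableOn_spectralDensity_mul_cos h2 h4 ((k i : ℝ) - k j)).const_mul
    (c i * c j)
  let T : ℝ → ℝ := fun l =>
    (∑ i, c i * cos (k i * l)) ^ 2 + (∑ i, c i * sin (k i * l)) ^ 2
  have hT (l : ℝ) : ∑ i, ∑ j, c i * c j * (spectralDensity p l * cos (((k i : ℝ) - k j) * l))
      = spectralDensity p l * T l := by
    simp only [T, ← sum_sum_mul_cos_sub c fun i => (k i : ℝ) * l, Finset.mul_sum, sub_mul]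
    refine Finset.sum_congr rfl fun i _ => Finset.sum_congr rfl fun j _ => ?_
    ring
  have hint : IntegrableOn (fun l => spectralDensity p l * T l) (Set.Ioi 0) := by
    simp_rw [← hT]
    exact integrable_finsetSum _ fun i _ => integrable_finsetSum _ fun j _ => hi i j
  have heq : ∑ i, ∑ j, c i * c j *
      ∫ l in Set.Ioi 0, spectralDensity p l * cos (((k i : ℝ) - k j) * l)
      = ∫ l in Set.Ioi 0, spectralDensity p l * T l := by
    simp_rw [← hT]
    rw [integral_finsetSum _ fun i _ => integrable_finsetSum _ fun j _ => hi i j]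
    refine Finset.sum_congr rfl fun i _ => ?_
    rw [integral_finsetSum _ fun j _ => hi i j]
    simp_rw [integral_const_mul]
  have hT0 (l : ℝ) : 0 ≤ T l := add_nonneg (sq_nonneg _) (sq_nonneg _)
  rw [heq, setIntegral_pos_iff_support_of_nonneg_ae ((ae_restrict_iff' measurableSet_Ioi).2
    (ae_of_all _ fun l hl => mul_nonneg (spectralDensity_nonneg p hl) (hT0 l))) hint]
  have hfin := finite_zeros_trigPoly hk hc
  refine lt_of_lt_of_le (b := volume (Set.Ioo (0 : ℝ) 1 \ {l ∈ Set.Ioo (0 : ℝ) 1 | T l = 0}))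
    ?_ (measure_mono fun l hl => ?_)
  · rw [measure_sdiff_null (hfin.measure_zero volume)]
    simp
  · exact ⟨mul_ne_zero (spectralDensity_pos p hl.1).ne' fun h0 => hl.2 ⟨hl.1, h0⟩, hl.1.1⟩

lemma gam_eq_integral {H : ℝ} (hH : H ∈ Set.Ioo (0 : ℝ) 1) (a b : ℕ) :
    gam H |(a : ℤ) - (b : ℤ)| =
      (4 * (2 * H + 1) * (H + 1) * ∫ l in Set.Ioi 0, powKernel (2 * H + 2) 1 l)⁻¹ *
        ∫ l in Set.Ioi 0, spectralDensity (2 * H + 2) l * cos (((a : ℝ) - b) * l) := by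
  have h2 : 2 < 2 * H + 2 := by linarith [hH.1]
  have h4 : 2 * H + 2 < 4 := by linarith [hH.2]
  have hcos (l : ℝ) : cos (((a : ℝ) - b) * l) = cos (|(a : ℝ) - b| * l) := by
    rcases abs_choice ((a : ℝ) - b) with h | h <;> simp [h, -neg_sub]
  have hK := (integral_powKernel_one_pos h2 h4).ne'
  simp_rw [hcos]
  rw [integral_spectralDensity_mul_cos h2 h4, gam]
  generalize (∫ l in Set.Ioi 0, powKernel (2 * H + 2) 1 l) = K at hK ⊢
  push_cast
  have h1 : 2 * H + 1 ≠ 0 := by linarith [hH.1]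
  have h3 : H + 1 ≠ 0 := by linarith [hH.1]
  field_simp

lemma isUnit_gam_matrix {H : ℝ} (hH : H ∈ Set.Ioo (0 : ℝ) 1) {ι : Type*} [Fintype ι]
    [DecidableEq ι] {k : ι → ℕ} (hk : Function.Injective k) :
    IsUnit (Matrix.of fun i j : ι => gam H |(k i : ℤ) - (k j : ℤ)|) := by
  have h2 : 2 < 2 * H + 2 := by linarith [hH.1]
  have h4 : 2 * H + 2 < 4 := by linarith [hH.2]
  have hpos : 0 < (4 * (2 * H + 1) * (H + 1) *
      ∫ l in Set.Ioi 0, powKernel (2 * H + 2) 1 l)⁻¹ := by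
    have h1 := integral_powKernel_one_pos h2 h4
    have h0 := hH.1
    positivity
  rw [← Matrix.mulVec_injective_iff_isUnit, ← Matrix.coe_mulVecLin, ← LinearMap.ker_eq_bot,
    LinearMap.ker_eq_bot']
  intro c hc
  by_contra hne
  have hq := mul_pos hpos (quadratic_form_fourth_difference_pos h2 h4 hk hne)
  refine hq.ne' ?_
  have h0 : c ⬝ᵥ ((Matrix.of fun i j : ι => gam H |(k i : ℤ) - (k j : ℤ)|) *ᵥ c) = 0 := by
    rw [← Matrix.mulVecLin_apply, hc, dotProduct_zero]
  refine Eq.trans ?_ h0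
  simp only [dotProduct, mulVec, Matrix.of_apply, gam_eq_integral hH, Finset.mul_sum]
  refine Finset.sum_congr rfl fun i _ => Finset.sum_congr rfl fun j _ => ?_
  ring

/-- Nonsingularity of the incremental covariance matrix: for `H ∈ (0,1)`,
`h > 0` and `k₁ < … < k_n`, the matrix with entries
`Cov(ΔX^h_{k_i}, ΔX^h_{k_j}) = h^{2H} γ(H, |k_i - k_j|)` has rank `n`; equivalently, the
matrix with entries `γ(H, |k_i - k_j|)` is invertible. -/
theorem incremental_covariance_matrix_nonsingular
    (H : ℝ) (hH : H ∈ Set.Ioo (0:ℝ) 1) (h : ℝ) (hh : 0 < h)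
    (n : ℕ) (k : Fin n → ℕ) (hk : StrictMono k) :
    (Matrix.of fun i j : Fin n => h ^ (2*H) * gam H |(k i : ℤ) - (k j : ℤ)|).rank = n ∧
    IsUnit (Matrix.of fun i j : Fin n => gam H |(k i : ℤ) - (k j : ℤ)|) := by
  have hu := isUnit_gam_matrix hH hk.injective
  refine ⟨?_, hu⟩
  have hs : IsUnit ((h ^ (2 * H)) • Matrix.of fun i j : Fin n =>
      gam H |(k i : ℤ) - (k j : ℤ)|) :=
    hu.smul (Units.mk0 _ (rpow_pos_of_pos hh (2 * H)).ne')
  exact (Matrix.rank_of_isUnit _ hs).trans (Fintype.card_fin n)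
end
end

section
/- The stationary Gaussian sequence {ΔX̃_k^h, k ∈ ℕ₀} is ergodic in the following sense: for every Borel measurable function Q : ℝ → ℝ with E|Q(ΔX̃_0^h)| < ∞, one has (1/N) ∑_{k=0}^{N−1} Q(ΔX̃_k^h) → E[Q(ΔX̃_0^h)] almost surely as N → ∞. -/
open MeasureTheory ProbabilityTheory Filter Real Matrix Topology

noncomputable section

variable {Ω : Type*} [MeasurableSpace Ω]

/-- `X̃_k^h = a X_{kh}^{h,H₁} + b X_{kh}^{h,H₂}`. -/
def tX (W₁ W₂ : ℝ → Ω → ℝ) (a b h : ℝ) (k : ℕ) (ω : Ω) : ℝ :=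
  a * nifBm W₁ h ((k:ℝ)*h) ω + b * nifBm W₂ h ((k:ℝ)*h) ω

/-- `ΔX̃_k^h = X̃_{k+1}^h - X̃_k^h`. -/
def dtX (W₁ W₂ : ℝ → Ω → ℝ) (a b h : ℝ) (k : ℕ) (ω : Ω) : ℝ :=
  tX W₁ W₂ a b h (k+1) ω - tX W₁ W₂ a b h k ω

section Birkhoff

variable {α : Type*}

/-- The maximum of the Birkhoff sums of `f` over the times `0, …, N`. -/
def birkhoffMax (T : α → α) (f : α → ℝ) : ℕ → α → ℝ
  | 0, _ => 0
  | N + 1, x => max 0 (f x + birkhoffMax T f N (T x))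

lemma birkhoffMax_nonneg (T : α → α) (f : α → ℝ) (N : ℕ) (x : α) : 0 ≤ birkhoffMax T f N x := by
  cases N <;> simp [birkhoffMax]

lemma birkhoffSum_le_birkhoffMax (T : α → α) (f : α → ℝ) (N : ℕ) (x : α) :
    birkhoffSum T f N x ≤ birkhoffMax T f N x := by
  induction N generalizing x with
  | zero => simp [birkhoffMax]
  | succ N ih =>
    rw [birkhoffSum_succ', birkhoffMax]
    exact le_max_of_le_right (by linarith [ih (T x)])

lemma birkhoffMax_mono (T : α → α) (f : α → ℝ) (x : α) : Monotone fun N => birkhoffMax T f N x := by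
  refine monotone_nat_of_le_succ fun N => ?_
  induction N generalizing x with
  | zero => exact birkhoffMax_nonneg T f 1 x
  | succ N ih =>
    simp only [birkhoffMax] at ih ⊢
    exact max_le_max le_rfl (by linarith [ih (T x)])

lemma bddAbove_birkhoffMax_comp_iff (T : α → α) (f : α → ℝ) (x : α) :
    BddAbove (Set.range fun N => birkhoffMax T f N (T x)) ↔
      BddAbove (Set.range fun N => birkhoffMax T f N x) := by
  constructor
  · rintro ⟨C, hC⟩
    refine ⟨max 0 (f x + C), ?_⟩
    rintro _ ⟨N, rfl⟩
    rcases N with _ | N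
    · simp [birkhoffMax]
    · exact max_le_max le_rfl (by linarith [hC ⟨N, rfl⟩])
  · rintro ⟨C, hC⟩
    refine ⟨C - f x, ?_⟩
    rintro _ ⟨N, rfl⟩
    have h1 : birkhoffMax T f (N + 1) x ≤ C := hC ⟨N + 1, rfl⟩
    have h2 : f x + birkhoffMax T f N (T x) ≤ birkhoffMax T f (N + 1) x := le_max_right _ _
    simp only
    linarith

variable [MeasurableSpace α]

lemma integrable_birkhoffMax {μ : Measure α} {T : α → α} (hT : MeasurePreserving T μ μ)
    {f : α → ℝ} (hf : Integrable f μ) (N : ℕ) : Integrable (birkhoffMax T f N) μ := by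
  induction N with
  | zero => exact integrable_zero _ _ _
  | succ N ih => exact (integrable_zero _ _ _).sup (hf.add (hT.integrable_comp_of_integrable ih))

lemma measurable_birkhoffMax {T : α → α} (hT : Measurable T) {f : α → ℝ} (hf : Measurable f)
    (N : ℕ) : Measurable (birkhoffMax T f N) := by
  induction N with
  | zero => exact measurable_const
  | succ N ih => exact measurable_const.max (hf.add (ih.comp hT))

/-- For an ergodic transformation, the Birkhoff sums of a function with negative integral are
almost everywhere bounded above. -/
lemma Ergodic.ae_bddAbove_birkhoffMax {μ : Measure α} {T : α → α} (hT : Ergodic T μ) {f : α → ℝ}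
    (hfm : Measurable f) (hf : Integrable f μ) (hneg : ∫ x, f x ∂μ < 0) :
    ∀ᵐ x ∂μ, BddAbove (Set.range fun N => birkhoffMax T f N x) := by
  have hmeas : MeasurableSet {x | BddAbove (Set.range fun N => birkhoffMax T f N x)} :=
    measurableSet_bddAbove_range fun N => measurable_birkhoffMax hT.measurable hfm N
  have hconst := hT.aeconst_set hmeas (Set.ext fun x => bddAbove_birkhoffMax_comp_iff T f x)
  rcases eventuallyConst_set.1 hconst with hbdd | hunb
  · exact hbdd
  exfalso
  have hlim : Tendsto (fun N => ∫ x, max (-birkhoffMax T f N (T x)) (f x) ∂μ) atTop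
      (𝓝 (∫ x, f x ∂μ)) := by
    refine tendsto_integral_of_dominated_convergence (fun x => |f x|) (fun N => ?_) hf.abs
      (fun N => ?_) ?_
    · exact ((measurable_birkhoffMax hT.measurable hfm N).comp hT.measurable).neg.max hfm
        |>.aestronglyMeasurable
    · refine ae_of_all _ fun x => ?_
      have h0 := birkhoffMax_nonneg T f N (T x)
      rw [Real.norm_eq_abs, abs_le]
      exact ⟨(neg_abs_le _).trans (le_max_right _ _),
        max_le (by linarith [abs_nonneg (f x)]) (le_abs_self _)⟩
    · filter_upwards [hunb] with x hx
      have hx' : ¬ BddAbove (Set.range fun N => birkhoffMax T f N (T x)) := fun hb =>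
        hx ((bddAbove_birkhoffMax_comp_iff T f x).1 hb)
      have htop := tendsto_atTop_atTop_of_monotone' (birkhoffMax_mono T f (T x)) hx'
      refine tendsto_const_nhds.congr' ?_
      filter_upwards [htop.eventually_ge_atTop (-f x)] with N hN
      exact (max_eq_right (by linarith)).symm
  refine absurd (ge_of_tendsto' hlim fun N => ?_) (not_le.2 hneg)
  have hi := integrable_birkhoffMax hT.toMeasurePreserving hf
  have heq : ∀ x, max (-birkhoffMax T f N (T x)) (f x) =
      birkhoffMax T f (N + 1) x - birkhoffMax T f N (T x) := fun x => by
    rw [birkhoffMax, ← max_sub_sub_right]; simp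
  have hcomp : ∫ x, birkhoffMax T f N (T x) ∂μ = ∫ x, birkhoffMax T f N x ∂μ := by
    have := integral_map (μ := μ) hT.measurable.aemeasurable (f := birkhoffMax T f N)
      (measurable_birkhoffMax hT.measurable hfm N).aestronglyMeasurable
    rw [← this, hT.map_eq]
  have hiT : Integrable (fun x => birkhoffMax T f N (T x)) μ :=
    hT.toMeasurePreserving.integrable_comp_of_integrable (hi N)
  simp_rw [heq]
  rw [integral_sub (hi _) hiT, hcomp, sub_nonneg]
  exact integral_mono (hi _) (hi _) fun x => birkhoffMax_mono T f x N.le_succ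

lemma Ergodic.ae_eventually_birkhoffAverage_lt {μ : Measure α} [IsProbabilityMeasure μ] {T : α → α}
    (hT : Ergodic T μ) {f : α → ℝ} (hfm : Measurable f) (hf : Integrable f μ) {c : ℝ}
    (hc : ∫ x, f x ∂μ < c) :
    ∀ᵐ x ∂μ, ∀ᶠ N in atTop, birkhoffAverage ℝ T f N x < c := by
  obtain ⟨d, hd, hdc⟩ := exists_between hc
  have hneg : ∫ x, (f x - d) ∂μ < 0 := by
    rw [integral_sub hf (integrable_const d)]
    simpa using hd
  filter_upwards [hT.ae_bddAbove_birkhoffMax (hfm.sub_const d) (hf.sub (integrable_const d)) hneg]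
    with x hx
  obtain ⟨C, hC⟩ := hx
  have hlim : Tendsto (fun N : ℕ => d + C / N) atTop (𝓝 (d + 0)) :=
    tendsto_const_nhds.add (tendsto_const_div_atTop_nhds_zero_nat C)
  filter_upwards [hlim.eventually_lt_const (by simpa using hdc),
    eventually_gt_atTop 0] with N hN hN0
  refine lt_of_le_of_lt ?_ hN
  have h1 := (birkhoffSum_le_birkhoffMax T (fun x => f x - d) N x).trans (hC ⟨N, rfl⟩)
  have h2 : birkhoffSum T (fun x => f x - d) N x = birkhoffSum T f N x - N * d := by
    simp [birkhoffSum]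
  have hN' : (0 : ℝ) < N := by exact_mod_cast hN0
  rw [birkhoffAverage, smul_eq_mul, inv_mul_le_iff₀ hN', mul_add, mul_div_cancel₀ _ hN'.ne']
  linarith

/-- Birkhoff's pointwise ergodic theorem. -/
theorem Ergodic.ae_tendsto_birkhoffAverage {μ : Measure α} [IsProbabilityMeasure μ] {T : α → α}
    (hT : Ergodic T μ) {f : α → ℝ} (hfm : Measurable f) (hf : Integrable f μ) :
    ∀ᵐ x ∂μ, Tendsto (fun N => birkhoffAverage ℝ T f N x) atTop (𝓝 (∫ x, f x ∂μ)) := by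
  have hpos (n : ℕ) : (0 : ℝ) < 1 / (n + 1) := by positivity
  have hup := ae_all_iff.2 fun n : ℕ => hT.ae_eventually_birkhoffAverage_lt hfm hf
    (lt_add_of_pos_right (∫ x, f x ∂μ) (hpos n))
  have hlow := ae_all_iff.2 fun n : ℕ => hT.ae_eventually_birkhoffAverage_lt hfm.neg hf.neg
    (lt_add_of_pos_right (∫ x, (-f) x ∂μ) (hpos n))
  filter_upwards [hup, hlow] with x hx₁ hx₂
  refine Metric.tendsto_nhds.2 fun ε hε => ?_
  obtain ⟨n, hn⟩ := exists_nat_one_div_lt hε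
  filter_upwards [hx₁ n, hx₂ n] with N h₁ h₂
  have h3 : birkhoffAverage ℝ T (-f) N x = -birkhoffAverage ℝ T f N x := by
    simp [birkhoffAverage, birkhoffSum]
  have h4 : ∫ x, (-f) x ∂μ = -∫ x, f x ∂μ := integral_neg _
  rw [Real.dist_eq, abs_lt]
  constructor <;> linarith

end Birkhoff

section Mixing

/-- If the vectors `e n` are uniformly bounded with asymptotically vanishing correlations, and
`g` has the same inner product with all of them, then this inner product is zero. -/
lemma inner_eq_zero_of_correlation_tendsto_zero {E : Type*} [NormedAddCommGroup E]
    [InnerProductSpace ℂ E] {e : ℕ → E} {g : E} {z : ℂ} {ρ : ℕ → ℂ}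
    (hg : ∀ n, inner ℂ g (e n) = z) (he : ∀ j n, inner ℂ (e j) (e (j + n)) = ρ n)
    (hρ : Tendsto ρ atTop (𝓝 0)) : z = 0 := by
  have hbound : ∀ ε > 0, ‖z‖ ^ 2 ≤ ‖g‖ ^ 2 * ε := by
    intro ε hε
    obtain ⟨K, hK⟩ := eventually_atTop.1 (Metric.tendsto_nhds.1 hρ ε hε)
    have hsmall : ∀ n, K + 1 ≤ n → ‖ρ n‖ ≤ ε := fun n hn => by
      simpa using (hK n (by omega)).le
    have hcorr : ∀ i j : ℕ, i ≠ j → ‖inner ℂ (e (i * (K + 1))) (e (j * (K + 1)))‖ ≤ ε := by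
      intro i j hij
      wlog hlt : i < j generalizing i j
      · rw [norm_inner_symm]
        exact this j i hij.symm (by omega)
      obtain ⟨d, rfl⟩ := Nat.exists_eq_add_of_lt hlt
      rw [show (i + d + 1) * (K + 1) = i * (K + 1) + (d + 1) * (K + 1) by ring, he]
      exact hsmall _ (Nat.le_mul_of_pos_left _ d.succ_pos)
    have hdiag : ∀ i, ‖inner ℂ (e i) (e i)‖ = ‖ρ 0‖ := fun i => by rw [← he i 0, add_zero]
    have hN : ∀ N : ℕ, 0 < N → ‖z‖ ^ 2 ≤ ‖g‖ ^ 2 * (‖ρ 0‖ / N + ε) := by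
      intro N hN
      have hN' : (0 : ℝ) < N := by exact_mod_cast hN
      set v := ∑ i ∈ Finset.range N, e (i * (K + 1)) with hv
      have h1 : inner ℂ g v = N * z := by simp [hv, hg]
      have h2 : ‖v‖ ^ 2 ≤ N * ‖ρ 0‖ + N * (N * ε) := by
        calc ‖v‖ ^ 2 = ‖inner ℂ v v‖ := by rw [inner_self_eq_norm_sq_to_K]; simp
          _ ≤ ∑ i ∈ Finset.range N, ∑ j ∈ Finset.range N,
                ‖inner ℂ (e (i * (K + 1))) (e (j * (K + 1)))‖ := by
              rw [hv, sum_inner]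
              refine (norm_sum_le _ _).trans (Finset.sum_le_sum fun i _ => ?_)
              rw [inner_sum]
              exact norm_sum_le _ _
          _ ≤ ∑ i ∈ Finset.range N, ∑ j ∈ Finset.range N, ((if i = j then ‖ρ 0‖ else 0) + ε) := by
              refine Finset.sum_le_sum fun i _ => Finset.sum_le_sum fun j _ => ?_
              split_ifs with hij
              · rw [hij, hdiag]; linarith
              · simpa using hcorr i j hij
          _ ≤ N * ‖ρ 0‖ + N * (N * ε) := by
              have hle : ∑ i ∈ Finset.range N, (if i < N then ‖ρ 0‖ else 0) ≤ N * ‖ρ 0‖ :=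
                (Finset.sum_le_sum (g := fun _ => ‖ρ 0‖) fun i _ => by
                  split_ifs <;> simp).trans (by simp)
              simpa [Finset.sum_add_distrib] using hle
      have h3 : (N * ‖z‖) ^ 2 ≤ ‖g‖ ^ 2 * ‖v‖ ^ 2 := by
        have := norm_inner_le_norm (𝕜 := ℂ) g v
        rw [h1, norm_mul, Complex.norm_natCast] at this
        rw [← mul_pow]
        gcongr
      have h4 : N ^ 2 * ‖z‖ ^ 2 ≤ N ^ 2 * (‖g‖ ^ 2 * (‖ρ 0‖ / N + ε)) := by
        calc (N : ℝ) ^ 2 * ‖z‖ ^ 2 ≤ ‖g‖ ^ 2 * (N * ‖ρ 0‖ + N * (N * ε)) := by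
              rw [← mul_pow]
              exact h3.trans (by gcongr)
          _ = _ := by field_simp
      exact le_of_mul_le_mul_left h4 (by positivity)
    have hlim : Tendsto (fun N : ℕ => ‖g‖ ^ 2 * (‖ρ 0‖ / N + ε)) atTop (𝓝 (‖g‖ ^ 2 * (0 + ε))) :=
      ((tendsto_const_div_atTop_nhds_zero_nat _).add_const ε).const_mul _
    rw [zero_add] at hlim
    refine ge_of_tendsto hlim ?_
    filter_upwards [eventually_gt_atTop 0] with N h using hN N h
  have hlim : Tendsto (fun ε : ℝ => ‖g‖ ^ 2 * ε) (𝓝[>] 0) (𝓝 (‖g‖ ^ 2 * 0)) :=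
    (tendsto_id.const_mul _).mono_left nhdsWithin_le_nhds
  have hz : ‖z‖ ^ 2 ≤ ‖g‖ ^ 2 * 0 :=
    ge_of_tendsto hlim (eventually_nhdsWithin_of_forall fun ε hε => hbound ε hε)
  have : ‖z‖ ^ 2 = 0 := le_antisymm (by simpa using hz) (by positivity)
  simpa using this

open scoped ComplexConjugate

/-- A mixing bounded observable is uncorrelated with every invariant set. -/
lemma MeasureTheory.MeasurePreserving.setIntegral_eq_of_mixing {α : Type*} [MeasurableSpace α]
    {μ : Measure α} [IsProbabilityMeasure μ] {T : α → α} (hT : MeasurePreserving T μ μ)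
    {χ : α → ℂ} (hχ : Measurable χ) {C : ℝ} (hC : ∀ x, ‖χ x‖ ≤ C)
    (hmix : Tendsto (fun n => ∫ x, χ (T^[n] x) * conj (χ x) ∂μ) atTop
      (𝓝 ((∫ x, χ x ∂μ) * conj (∫ x, χ x ∂μ))))
    {A : Set α} (hA : MeasurableSet A) (hinv : T ⁻¹' A = A) :
    ∫ x in A, χ x ∂μ = μ.real A * ∫ x, χ x ∂μ := by
  set φ := ∫ x, χ x ∂μ with hφ
  have hTn : ∀ n, MeasurePreserving T^[n] μ μ := fun n => hT.iterate n
  have hmeas : ∀ n, Measurable fun x => χ (T^[n] x) - φ := fun n =>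
    (hχ.comp (hTn n).measurable).sub_const φ
  have hmem : ∀ n, MemLp (fun x => χ (T^[n] x) - φ) 2 μ := fun n =>
    MemLp.of_bound (hmeas n).aestronglyMeasurable (C + ‖φ‖) (ae_of_all _ fun x =>
      (norm_sub_le _ _).trans (by linarith [hC (T^[n] x)]))
  have hint : ∀ n, Integrable (fun x => χ (T^[n] x)) μ := fun n =>
    Integrable.of_bound (hχ.comp (hTn n).measurable).aestronglyMeasurable C
      (ae_of_all _ fun x => hC _)
  have hint2 : ∀ n, Integrable (fun x => χ (T^[n] x) * conj (χ x)) μ := fun n =>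
    Integrable.of_bound ((hχ.comp (hTn n).measurable).mul
      (Complex.continuous_conj.measurable.comp hχ)).aestronglyMeasurable (C * C)
      (ae_of_all _ fun x => by
        rw [norm_mul, RCLike.norm_conj]
        exact mul_le_mul (hC _) (hC _) (norm_nonneg _) ((norm_nonneg _).trans (hC x)))
  have hcomp : ∀ (n : ℕ) (f : α → ℂ), Measurable f → ∫ x, f (T^[n] x) ∂μ = ∫ x, f x ∂μ := by
    intro n f hf
    rw [← integral_map (hTn n).measurable.aemeasurable hf.aestronglyMeasurable, (hTn n).map_eq]
  have hinvn : ∀ n, T^[n] ⁻¹' A = A := fun n => by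
    induction n with
    | zero => rfl
    | succ n ih => rw [Function.iterate_succ', Set.preimage_comp, hinv, ih]
  have hg : ∀ n, inner ℂ (indicatorConstLp 2 hA (measure_ne_top μ A) (1 : ℂ)) ((hmem n).toLp _) =
      ∫ x in A, (χ x - φ) ∂μ := by
    intro n
    rw [L2.inner_indicatorConstLp_one]
    calc _ = ∫ x in A, (χ (T^[n] x) - φ) ∂μ :=
          setIntegral_congr_ae hA ((hmem n).coeFn_toLp.mono fun x hx _ => hx)
      _ = ∫ x in T^[n] ⁻¹' A, (χ (T^[n] x) - φ) ∂μ := by rw [hinvn]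
      _ = ∫ x in A, (χ x - φ) ∂(μ.map T^[n]) :=
          (setIntegral_map hA (hχ.sub_const φ).aestronglyMeasurable
            (hTn n).measurable.aemeasurable).symm
      _ = _ := by rw [(hTn n).map_eq]
  have he : ∀ j n, inner ℂ ((hmem j).toLp _) ((hmem (j + n)).toLp _) =
      ∫ x, χ (T^[n] x) * conj (χ x) ∂μ - φ * conj φ := by
    intro j n
    rw [L2.inner_def]
    calc _ = ∫ x, (χ (T^[n] (T^[j] x)) - φ) * conj (χ (T^[j] x) - φ) ∂μ := by
          refine integral_congr_ae ?_
          filter_upwards [(hmem j).coeFn_toLp, (hmem (j + n)).coeFn_toLp] with x h1 h2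
          rw [h1, h2, RCLike.inner_apply, add_comm, Function.iterate_add_apply]
      _ = ∫ x, (χ (T^[n] x) - φ) * conj (χ x - φ) ∂μ :=
          hcomp j (fun x => (χ (T^[n] x) - φ) * conj (χ x - φ))
            ((hmeas n).mul (Complex.continuous_conj.measurable.comp (hχ.sub_const φ)))
      _ = ∫ x, (χ (T^[n] x) * conj (χ x) - χ (T^[n] x) * conj φ - φ * conj (χ x)
            + φ * conj φ) ∂μ := by
          congr 1; ext x; rw [map_sub]; ring
      _ = _ := by
          have hc : Integrable (fun x => conj (χ x)) μ := by
            exact Complex.conjCLE.toContinuousLinearMap.integrable_comp (hint 0)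
          have i₁ : Integrable (fun x => χ (T^[n] x) * conj φ) μ := (hint n).mul_const _
          have i₂ : Integrable (fun x => φ * conj (χ x)) μ := hc.const_mul _
          have i₃ : Integrable (fun x => χ (T^[n] x) * conj (χ x) - χ (T^[n] x) * conj φ) μ :=
            (hint2 n).sub i₁
          have i₄ : Integrable (fun x => χ (T^[n] x) * conj (χ x) - χ (T^[n] x) * conj φ
              - φ * conj (χ x)) μ := i₃.sub i₂
          rw [integral_add i₄ (integrable_const _), integral_sub i₃ i₂, integral_sub (hint2 n) i₁,
            integral_mul_const, integral_const_mul, integral_conj, hcomp n χ hχ]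
          simp [← hφ]
  have hz := inner_eq_zero_of_correlation_tendsto_zero hg he 
    (by simpa using hmix.sub_const (φ * conj φ))
  have i₀ : IntegrableOn χ A μ := (hint 0).integrableOn
  rw [integral_sub i₀ (integrable_const _)] at hz
  simpa using sub_eq_zero.1 hz

/-- The character of `ι → ℝ` with frequency `c` supported in the finite set `I`. -/
def piChar {ι : Type*} (I : Finset ι) (c : ι → ℝ) (x : ι → ℝ) : ℂ :=
  Complex.exp ((∑ k ∈ I, c k * x k : ℝ) * Complex.I)

lemma measurable_piChar {ι : Type*} (I : Finset ι) (c : ι → ℝ) : Measurable (piChar I c) := by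
  unfold piChar
  fun_prop

lemma norm_piChar {ι : Type*} (I : Finset ι) (c x : ι → ℝ) : ‖piChar I c x‖ = 1 :=
  Complex.norm_exp_ofReal_mul_I _

/-- Finite measures on a product of real lines are determined by their integrals of characters. -/
lemma MeasureTheory.Measure.ext_of_integral_piChar {ι : Type*} {μ ν : Measure (ι → ℝ)}
    [IsFiniteMeasure μ] [IsFiniteMeasure ν]
    (h : ∀ I c, ∫ x, piChar I c x ∂μ = ∫ x, piChar I c x ∂ν) : μ = ν := by
  classical
  refine IsProjectiveLimit.unique (P := fun I => μ.map I.restrict) (fun I => rfl) fun I => ?_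
  refine Measure.ext_of_charFunDual ?_
  have hlin : ∀ (L : StrongDual ℝ (I → ℝ)) (y : I → ℝ), L y = ∑ k, L (Pi.single k 1) * y k := by
    intro L y
    conv_lhs => rw [← Finset.univ_sum_single y, _root_.map_sum]
    refine Finset.sum_congr rfl fun k _ => ?_
    have : Pi.single k (y k) = y k • (Pi.single k 1 : I → ℝ) := by
      rw [← Pi.single_smul]; simp
    rw [this, map_smul, smul_eq_mul, mul_comm]
  refine funext fun (L : StrongDual ℝ (I → ℝ)) => ?_
  have hL : ∀ x : ι → ℝ, L (I.restrict x) =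
      ∑ k ∈ I, (if hk : k ∈ I then L (Pi.single ⟨k, hk⟩ 1) else 0) * x k := by
    intro x
    rw [← Finset.sum_coe_sort]
    refine (hlin L (I.restrict x)).trans (Finset.sum_congr rfl fun k _ => ?_)
    rw [dif_pos k.2]
    rfl
  rw [charFunDual_apply, charFunDual_apply,
    integral_map (by fun_prop) (by fun_prop), integral_map (by fun_prop) (by fun_prop)]
  simp_rw [hL]
  exact (h I _).symm

/-- A measure-preserving transformation of a product of real lines is ergodic as soon as it is
mixing on characters. -/
lemma MeasureTheory.MeasurePreserving.ergodic_of_mixing_piChar {ι : Type*} {μ : Measure (ι → ℝ)}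
    [IsProbabilityMeasure μ] {T : (ι → ℝ) → (ι → ℝ)} (hT : MeasurePreserving T μ μ)
    (hmix : ∀ I c, Tendsto (fun n => ∫ x, piChar I c (T^[n] x) * conj (piChar I c x) ∂μ) atTop
      (𝓝 ((∫ x, piChar I c x ∂μ) * conj (∫ x, piChar I c x ∂μ)))) : Ergodic T μ := by
  refine ⟨hT, ⟨fun A hA hinv => ?_⟩⟩
  have heq : μ.restrict A = μ A • μ := by
    have : IsFiniteMeasure (μ A • μ) := Measure.smul_finite μ (measure_ne_top μ A)
    refine Measure.ext_of_integral_piChar fun I c => ?_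
    rw [hT.setIntegral_eq_of_mixing (measurable_piChar I c) (fun x => (norm_piChar I c x).le)
      (hmix I c) hA hinv, integral_smul_measure]
    simp [Measure.real]
  have h0 : μ A * μ Aᶜ = 0 := by
    have := congrArg (fun m : Measure (ι → ℝ) => m Aᶜ) heq
    simpa [Measure.restrict_apply hA.compl] using this.symm
  rw [eventuallyConst_set']
  rcases mul_eq_zero.1 h0 with h | h
  · exact Or.inl (ae_eq_empty.2 h)
  · exact Or.inr (ae_eq_univ.2 h)

end Mixing

section GaussianSpace

open scoped ComplexConjugate

/-- A space of random variables all of which are centered Gaussian. -/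
def IsGaussianSpace (P : Measure Ω) (V : Submodule ℝ (Ω → ℝ)) : Prop :=
  ∀ G ∈ V, ∃ v : NNReal, P.map G = gaussianReal 0 v

variable {P : Measure Ω} {V : Submodule ℝ (Ω → ℝ)}

lemma IsGaussianSpace.aemeasurable (hV : IsGaussianSpace P V) {G : Ω → ℝ} (hG : G ∈ V) :
    AEMeasurable G P := by
  obtain ⟨v, hv⟩ := hV G hG
  refine AEMeasurable.of_map_ne_zero ?_
  rw [hv]
  exact IsProbabilityMeasure.ne_zero _

lemma IsGaussianSpace.memLp (hV : IsGaussianSpace P V) {G : Ω → ℝ} (hG : G ∈ V) :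
    MemLp G 2 P := by
  obtain ⟨v, hv⟩ := hV G hG
  have h := memLp_id_gaussianReal (μ := 0) (v := v) 2
  rw [← hv] at h
  exact (memLp_map_measure_iff aestronglyMeasurable_id (hV.aemeasurable hG)).1 h

lemma IsGaussianSpace.integrable_mul (hV : IsGaussianSpace P V) {G G' : Ω → ℝ} (hG : G ∈ V)
    (hG' : G' ∈ V) : Integrable (fun ω => G ω * G' ω) P :=
  (hV.memLp hG).integrable_mul (hV.memLp hG')

lemma IsGaussianSpace.integral_eq_zero (hV : IsGaussianSpace P V) {G : Ω → ℝ} (hG : G ∈ V) :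
    ∫ ω, G ω ∂P = 0 := by
  obtain ⟨v, hv⟩ := hV G hG
  have h := integral_map (hV.aemeasurable hG) (f := fun x : ℝ => x) aestronglyMeasurable_id
  rw [← h, hv, integral_id_gaussianReal]

lemma IsGaussianSpace.integral_cexp (hV : IsGaussianSpace P V) {G : Ω → ℝ} (hG : G ∈ V) :
    ∫ ω, Complex.exp (G ω * Complex.I) ∂P = (Real.exp (-(∫ ω, G ω * G ω ∂P) / 2) : ℝ) := by
  obtain ⟨v, hv⟩ := hV G hG
  have hm := hV.aemeasurable hG
  have hvar : ∫ ω, G ω * G ω ∂P = v := by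
    have h1 := integral_map hm (f := fun x : ℝ => x * x) (by fun_prop)
    have h2 := variance_id_gaussianReal (μ := 0) (v := v)
    rw [variance_eq_integral (by fun_prop)] at h2
    rw [← h1, hv, ← h2]
    simp [integral_id_gaussianReal, sq]
  have h3 := charFun_gaussianReal (μ := 0) (v := v) 1
  rw [← hv, charFun_apply_real, integral_map hm (by fun_prop)] at h3
  rw [hvar]
  simp only [Complex.ofReal_one, one_mul] at h3
  rw [h3]
  push_cast
  congr 1
  ring

/-- The linear combination of the `X k`, `k ∈ I`, with coefficients `c k`. -/
def linComb (I : Finset ℕ) (c : ℕ → ℝ) (X : ℕ → Ω → ℝ) (ω : Ω) : ℝ := ∑ k ∈ I, c k * X k ω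

omit [MeasurableSpace Ω] in
lemma linComb_mem {X : ℕ → Ω → ℝ} (hX : ∀ k, X k ∈ V) (I : Finset ℕ) (c : ℕ → ℝ) :
    linComb I c X ∈ V := by
  have : linComb I c X = ∑ k ∈ I, c k • X k := by ext ω; simp [linComb]
  rw [this]
  exact V.sum_mem fun k _ => V.smul_mem _ (hX k)

lemma IsGaussianSpace.integral_linComb_mul (hV : IsGaussianSpace P V) {X X' : ℕ → Ω → ℝ}
    (hX : ∀ k, X k ∈ V) (hX' : ∀ k, X' k ∈ V) (I : Finset ℕ) (c : ℕ → ℝ) :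
    ∫ ω, linComb I c X ω * linComb I c X' ω ∂P =
      ∑ k ∈ I, ∑ l ∈ I, c k * c l * ∫ ω, X k ω * X' l ω ∂P := by
  have hi : ∀ k l, Integrable (fun ω => c k * c l * (X k ω * X' l ω)) P := fun k l =>
    (hV.integrable_mul (hX k) (hX' l)).const_mul _
  calc _ = ∫ ω, ∑ k ∈ I, ∑ l ∈ I, c k * c l * (X k ω * X' l ω) ∂P := by
        congr 1; ext ω
        rw [linComb, linComb, Finset.sum_mul_sum]
        exact Finset.sum_congr rfl fun k _ => Finset.sum_congr rfl fun l _ => by ring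
    _ = _ := by
        rw [integral_finsetSum _ fun k _ => integrable_finsetSum _ fun l _ => hi k l]
        refine Finset.sum_congr rfl fun k _ => ?_
        rw [integral_finsetSum _ fun l _ => hi k l]
        exact Finset.sum_congr rfl fun l _ => integral_const_mul _ _

lemma IsGaussianSpace.tendsto_exp_of_ae_tendsto [IsProbabilityMeasure P]
    (hV : IsGaussianSpace P V) {G : ℕ → Ω → ℝ} (hG : ∀ n, G n ∈ V) {g : Ω → ℝ}
    (hlim : ∀ᵐ ω ∂P, Tendsto (fun n => G n ω) atTop (𝓝 (g ω))) :
    Tendsto (fun n => ((Real.exp (-(∫ ω, G n ω * G n ω ∂P) / 2) : ℝ) : ℂ)) atTop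
      (𝓝 (∫ ω, Complex.exp (g ω * Complex.I) ∂P)) := by
  simp_rw [← fun n => hV.integral_cexp (hG n)]
  refine tendsto_integral_of_dominated_convergence (fun _ => 1) (fun n => ?_)
    (integrable_const _) (fun n => ae_of_all _ fun ω => (Complex.norm_exp_ofReal_mul_I _).le) ?_
  · have := hV.aemeasurable (hG n)
    exact AEMeasurable.aestronglyMeasurable (by fun_prop)
  · filter_upwards [hlim] with ω hω
    exact (Complex.continuous_exp.tendsto _).comp
      (((Complex.continuous_ofReal.tendsto _).comp hω).mul_const _)

/-- Almost sure limits of stationary Gaussian sequences with uniformly decaying correlations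
satisfy the ergodic theorem. -/
theorem IsGaussianSpace.ae_tendsto_average [IsProbabilityMeasure P] (hV : IsGaussianSpace P V)
    {Z : ℕ → ℕ → Ω → ℝ} (hZ : ∀ n k, Z n k ∈ V) {Y : ℕ → Ω → ℝ} (hY : ∀ k, Measurable (Y k))
    (hlim : ∀ᵐ ω ∂P, ∀ k, Tendsto (fun n => Z n k ω) atTop (𝓝 (Y k ω)))
    (hstat : ∀ n j k, ∫ ω, Z n (j + 1) ω * Z n (k + 1) ω ∂P = ∫ ω, Z n j ω * Z n k ω ∂P)
    (hdecay : ∀ ε > 0, ∃ K, ∀ n j k, j + K ≤ k → |∫ ω, Z n k ω * Z n j ω ∂P| ≤ ε)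
    {Q : ℝ → ℝ} (hQ : Measurable Q) (hint : Integrable (fun ω => Q (Y 0 ω)) P) :
    ∀ᵐ ω ∂P, Tendsto (fun N : ℕ => (1 / (N : ℝ)) * ∑ k ∈ Finset.range N, Q (Y k ω)) atTop
      (𝓝 (∫ ω, Q (Y 0 ω) ∂P)) := by
  set Yv : Ω → ℕ → ℝ := fun ω k => Y k ω with hYv
  have hYm : Measurable Yv := measurable_pi_lambda _ hY
  set T : (ℕ → ℝ) → (ℕ → ℝ) := fun x k => x (k + 1) with hT
  have hTm : Measurable T := measurable_pi_lambda _ fun k => measurable_pi_apply _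
  have hTp : ∀ p x k, (T^[p] x) k = x (k + p) := by
    intro p
    induction p with
    | zero => intro x k; rfl
    | succ p ih => intro x k; rw [Function.iterate_succ_apply, ih]; simp [hT]; ring_nf
  set μ : Measure (ℕ → ℝ) := P.map Yv with hμ
  have : IsProbabilityMeasure μ := Measure.isProbabilityMeasure_map hYm.aemeasurable
  have hZs : ∀ n p k, Z n (k + p) ∈ V := fun n p k => hZ n _
  have hstat' : ∀ n p j k, ∫ ω, Z n (j + p) ω * Z n (k + p) ω ∂P = ∫ ω, Z n j ω * Z n k ω ∂P := by
    intro n p j k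
    induction p with
    | zero => rfl
    | succ p ih => rw [← ih, ← hstat n (j + p) (k + p)]; rfl
  have hq : ∀ n p I c, ∫ ω, linComb I c (fun k => Z n (k + p)) ω *
      linComb I c (fun k => Z n (k + p)) ω ∂P =
      ∫ ω, linComb I c (Z n) ω * linComb I c (Z n) ω ∂P := by
    intro n p I c
    rw [hV.integral_linComb_mul (hZs n p) (hZs n p), hV.integral_linComb_mul (hZ n) (hZ n)]
    simp_rw [hstat']
  have hlimc : ∀ p I c, ∀ᵐ ω ∂P, Tendsto (fun n => linComb I c (fun k => Z n (k + p)) ω) atTop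
      (𝓝 (linComb I c (fun k => Y (k + p)) ω)) := by
    intro p I c
    filter_upwards [hlim] with ω hω
    exact tendsto_finsetSum _ fun k _ => (hω (k + p)).const_mul _
  have hchar : ∀ p I c, Tendsto (fun n => ((Real.exp (-(∫ ω, linComb I c (Z n) ω *
      linComb I c (Z n) ω ∂P) / 2) : ℝ) : ℂ)) atTop (𝓝 (∫ x, piChar I c (T^[p] x) ∂μ)) := by
    intro p I c
    have h := hV.tendsto_exp_of_ae_tendsto (fun n => linComb_mem (hZs n p) I c) (hlimc p I c)
    simp_rw [hq] at h
    convert h using 2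
    have hpm : Measurable fun x => piChar I c (T^[p] x) :=
      (measurable_piChar I c).comp (hTm.iterate p)
    rw [hμ, integral_map hYm.aemeasurable hpm.aestronglyMeasurable]
    simp only [piChar, hTp, linComb, hYv]
  have hTμ : MeasurePreserving T μ μ := by
    refine ⟨hTm, ?_⟩
    have : IsProbabilityMeasure (μ.map T) := Measure.isProbabilityMeasure_map hTm.aemeasurable
    refine Measure.ext_of_integral_piChar fun I c => ?_
    rw [integral_map hTm.aemeasurable (measurable_piChar I c).aestronglyMeasurable]
    exact tendsto_nhds_unique (hchar 1 I c) (hchar 0 I c)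
  have herg : Ergodic T μ := by
    refine hTμ.ergodic_of_mixing_piChar fun I c => ?_
    set φ := ∫ x, piChar I c x ∂μ with hφ
    set q : ℕ → ℝ := fun n => ∫ ω, linComb I c (Z n) ω * linComb I c (Z n) ω ∂P with hqdef
    have hφlim : Tendsto (fun n => ((Real.exp (-q n / 2) : ℝ) : ℂ)) atTop (𝓝 φ) := hchar 0 I c
    have hφφ : Tendsto (fun n => ((Real.exp (-q n) : ℝ) : ℂ)) atTop (𝓝 (φ * conj φ)) := by
      have h := hφlim.mul ((Complex.continuous_conj.tendsto _).comp hφlim)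
      refine h.congr fun n => ?_
      simp only [Function.comp, Complex.conj_ofReal]
      rw [← Complex.ofReal_mul, ← Real.exp_add]
      congr 2
      ring
    set r : ℕ → ℕ → ℝ := fun p n => ∫ ω, linComb I c (fun k => Z n (k + p)) ω *
      linComb I c (Z n) ω ∂P with hr
    have hcross : ∀ p, Tendsto (fun n => ((Real.exp (-q n + r p n) : ℝ) : ℂ)) atTop
        (𝓝 (∫ x, piChar I c (T^[p] x) * conj (piChar I c x) ∂μ)) := by
      intro p
      have hmem : ∀ n, (fun ω => linComb I c (fun k => Z n (k + p)) ω - linComb I c (Z n) ω) ∈ V :=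
        fun n => V.sub_mem (linComb_mem (hZs n p) I c) (linComb_mem (hZ n) I c)
      have h := hV.tendsto_exp_of_ae_tendsto hmem (g := fun ω =>
        linComb I c (fun k => Y (k + p)) ω - linComb I c Y ω) (by
          filter_upwards [hlimc p I c, hlimc 0 I c] with ω h₁ h₂ using h₁.sub h₂)
      have hmm : Measurable fun x => piChar I c (T^[p] x) * conj (piChar I c x) :=
        ((measurable_piChar I c).comp (hTm.iterate p)).mul
          (Complex.continuous_conj.measurable.comp (measurable_piChar I c))
      convert h using 2 with n
      · have i₁ := hV.integrable_mul (linComb_mem (hZs n p) I c) (linComb_mem (hZs n p) I c)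
        have i₂ := hV.integrable_mul (linComb_mem (hZs n p) I c) (linComb_mem (hZ n) I c)
        have i₃ := hV.integrable_mul (linComb_mem (hZ n) I c) (linComb_mem (hZ n) I c)
        have hsq : ∫ ω, (linComb I c (fun k => Z n (k + p)) ω - linComb I c (Z n) ω) *
            (linComb I c (fun k => Z n (k + p)) ω - linComb I c (Z n) ω) ∂P =
            q n - 2 * r p n + q n := by
          set A := linComb I c (fun k => Z n (k + p))
          set B := linComb I c (Z n)
          have i₄ : Integrable (fun ω => A ω * A ω - 2 * (A ω * B ω)) P := i₁.sub (i₂.const_mul 2)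
          calc _ = ∫ ω, (A ω * A ω - 2 * (A ω * B ω) + B ω * B ω) ∂P := by
                congr 1; ext ω; ring
            _ = _ := by
                rw [integral_add i₄ i₃, integral_sub i₁ (i₂.const_mul 2), integral_const_mul,
                  hq n p I c]
        rw [hsq]
        congr 2
        ring
      · rw [hμ, integral_map hYm.aemeasurable hmm.aestronglyMeasurable]
        congr 1
        ext ω
        simp only [piChar, hTp, hYv, linComb]
        rw [← Complex.exp_conj, ← Complex.exp_add]
        congr 1
        simp only [map_mul, Complex.conj_ofReal, Complex.conj_I]
        push_cast
        ring
    refine Metric.tendsto_nhds.2 fun ε hε => ?_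
    set D := ∑ k ∈ I, ∑ l ∈ I, |c k * c l| with hD
    have hD0 : 0 ≤ D := Finset.sum_nonneg fun _ _ => Finset.sum_nonneg fun _ _ => abs_nonneg _
    set η := min 1 (ε / 4) with hη
    have hη0 : 0 < η := by positivity
    obtain ⟨K, hK⟩ := hdecay (η / (D + 1)) (by positivity)
    filter_upwards [eventually_ge_atTop (K + I.sup id)] with p hp
    have hr_le : ∀ n, |r p n| ≤ η := by
      intro n
      rw [hr]
      simp only
      rw [hV.integral_linComb_mul (hZs n p) (hZ n)]
      calc _ ≤ ∑ k ∈ I, ∑ l ∈ I, |c k * c l| * (η / (D + 1)) := by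
            refine (Finset.abs_sum_le_sum_abs _ _).trans (Finset.sum_le_sum fun k _ => ?_)
            refine (Finset.abs_sum_le_sum_abs _ _).trans (Finset.sum_le_sum fun l hl => ?_)
            rw [abs_mul]
            refine mul_le_mul_of_nonneg_left (hK n l (k + p) ?_) (abs_nonneg _)
            have : l ≤ I.sup id := Finset.le_sup (f := id) hl
            omega
        _ = η * (D / (D + 1)) := by
            simp_rw [← Finset.sum_mul]
            ring
        _ ≤ η * 1 := by
            gcongr
            rw [div_le_one (by positivity)]
            linarith
        _ = η := mul_one _
    rw [dist_eq_norm]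
    refine lt_of_le_of_lt (b := ε / 2) ?_ (by linarith)
    refine le_of_tendsto' ((hcross p).sub hφφ).norm fun n => ?_
    rw [← Complex.ofReal_sub, Complex.norm_real, Real.norm_eq_abs, Real.exp_add,
      ← mul_sub_one, abs_mul, Real.abs_exp]
    have hq0 : 0 ≤ q n := integral_nonneg fun ω => mul_self_nonneg _
    calc _ ≤ 1 * (2 * |r p n|) := by
          gcongr
          · simpa using hq0
          · exact Real.abs_exp_sub_one_le ((hr_le n).trans (min_le_left _ _))
      _ ≤ ε / 2 := by linarith [hr_le n, min_le_right 1 (ε / 4)]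
  have hf : Measurable fun x : ℕ → ℝ => Q (x 0) := hQ.comp (measurable_pi_apply 0)
  have hfi : Integrable (fun x : ℕ → ℝ => Q (x 0)) μ :=
    (integrable_map_measure hf.aestronglyMeasurable hYm.aemeasurable).2 hint
  have hmain := ae_of_ae_map hYm.aemeasurable (herg.ae_tendsto_birkhoffAverage hf hfi)
  filter_upwards [hmain] with ω hω
  rw [hμ, integral_map hYm.aemeasurable hf.aestronglyMeasurable] at hω
  refine hω.congr fun N => ?_
  simp [birkhoffAverage, birkhoffSum, hTp, hYv]

end GaussianSpace

section FractionalBrownianMotion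

/-- The span of the values of a process at nonnegative times. -/
def processSpan (W : ℝ → Ω → ℝ) : Submodule ℝ (Ω → ℝ) := Submodule.span ℝ (W '' Set.Ici 0)

omit [MeasurableSpace Ω] in
lemma mem_processSpan (W : ℝ → Ω → ℝ) {t : ℝ} (ht : 0 ≤ t) : W t ∈ processSpan W :=
  Submodule.subset_span ⟨t, ht, rfl⟩

omit [MeasurableSpace Ω] in
lemma exists_measurable_of_mem_processSpan {W : ℝ → Ω → ℝ} {G : Ω → ℝ} (hG : G ∈ processSpan W) :
    ∃ F : (ℝ → ℝ) → ℝ, Measurable F ∧ G = F ∘ fun ω t => W t ω := by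
  induction hG using Submodule.span_induction with
  | mem G hG =>
    obtain ⟨t, -, rfl⟩ := hG
    exact ⟨fun f => f t, measurable_pi_apply t, rfl⟩
  | zero => exact ⟨fun _ => 0, measurable_const, rfl⟩
  | add G G' _ _ ih ih' =>
    obtain ⟨F, hF, rfl⟩ := ih
    obtain ⟨F', hF', rfl⟩ := ih'
    exact ⟨fun f => F f + F' f, hF.add hF', rfl⟩
  | smul c G _ ih =>
    obtain ⟨F, hF, rfl⟩ := ih
    exact ⟨fun f => c * F f, hF.const_mul c, rfl⟩

variable {P : Measure Ω} {H : ℝ} {W : ℝ → Ω → ℝ}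

lemma IsFBM.isGaussianSpace (hW : IsFBM P H W) : IsGaussianSpace P (processSpan W) := by
  intro G hG
  obtain ⟨n, f, g, rfl⟩ := Submodule.mem_span_set'.1 hG
  choose t ht hgt using fun i => (g i).2
  obtain ⟨v, hv⟩ := hW.gaussian_fdd n t ht f
  refine ⟨v, ?_⟩
  rw [← hv]
  congr 1
  ext ω
  simp [hgt]

lemma indepFun_of_mem_processSpan {W₁ W₂ : ℝ → Ω → ℝ}
    (hIndep : IndepFun (fun ω t => W₁ t ω) (fun ω t => W₂ t ω) P) {G₁ G₂ : Ω → ℝ}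
    (hG₁ : G₁ ∈ processSpan W₁) (hG₂ : G₂ ∈ processSpan W₂) : IndepFun G₁ G₂ P := by
  obtain ⟨F₁, hF₁, rfl⟩ := exists_measurable_of_mem_processSpan hG₁
  obtain ⟨F₂, hF₂, rfl⟩ := exists_measurable_of_mem_processSpan hG₂
  exact hIndep.comp hF₁ hF₂

lemma isGaussianSpace_sup {W₁ W₂ : ℝ → Ω → ℝ} (h₁ : IsGaussianSpace P (processSpan W₁))
    (h₂ : IsGaussianSpace P (processSpan W₂))
    (hIndep : IndepFun (fun ω t => W₁ t ω) (fun ω t => W₂ t ω) P) :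
    IsGaussianSpace P (processSpan W₁ ⊔ processSpan W₂) := by
  intro G hG
  obtain ⟨G₁, hG₁, G₂, hG₂, rfl⟩ := Submodule.mem_sup.1 hG
  obtain ⟨v₁, hv₁⟩ := h₁ G₁ hG₁
  obtain ⟨v₂, hv₂⟩ := h₂ G₂ hG₂
  refine ⟨v₁ + v₂, ?_⟩
  rw [gaussianReal_add_gaussianReal_of_indepFun (indepFun_of_mem_processSpan hIndep hG₁ hG₂)
    hv₁ hv₂, add_zero]

/-- The covariance of two increments of fractional Brownian motion over windows of length `h`,
as a function of the lag `u`. -/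
def fbmIncrCov (H h u : ℝ) : ℝ :=
  (|u + h| ^ (2 * H) + |u - h| ^ (2 * H) - 2 * |u| ^ (2 * H)) / 2

lemma IsFBM.integral_incr_mul_incr (hW : IsFBM P H W) {h x y : ℝ} (hh : 0 ≤ h) (hx : 0 ≤ x)
    (hy : 0 ≤ y) :
    ∫ ω, (W (x + h) ω - W x ω) * (W (y + h) ω - W y ω) ∂P = fbmIncrCov H h (x - y) := by
  have hi : ∀ {s t : ℝ}, 0 ≤ s → 0 ≤ t → Integrable (fun ω => W s ω * W t ω) P := fun hs ht =>
    hW.isGaussianSpace.integrable_mul (mem_processSpan W hs) (mem_processSpan W ht)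
  have hxh : 0 ≤ x + h := by positivity
  have hyh : 0 ≤ y + h := by positivity
  have i₁ : Integrable (fun ω => W (x + h) ω * W (y + h) ω - W (x + h) ω * W y ω) P :=
    (hi hxh hyh).sub (hi hxh hy)
  have i₂ : Integrable (fun ω => W x ω * W (y + h) ω - W x ω * W y ω) P :=
    (hi hx hyh).sub (hi hx hy)
  calc _ = ∫ ω, ((W (x + h) ω * W (y + h) ω - W (x + h) ω * W y ω) -
          (W x ω * W (y + h) ω - W x ω * W y ω)) ∂P := by
        congr 1; ext ω; ring
    _ = _ := by
        rw [integral_sub i₁ i₂, integral_sub (hi hxh hyh) (hi hxh hy),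
          integral_sub (hi hx hyh) (hi hx hy), hW.cov _ _ hxh hyh, hW.cov _ _ hxh hy,
          hW.cov _ _ hx hyh, hW.cov _ _ hx hy, fbmIncrCov,
          show x + h - (y + h) = x - y by ring, show x + h - y = x - y + h by ring,
          show x - (y + h) = x - y - h by ring]
        ring

lemma tendsto_fbmIncrCov_atTop (hH : H < 1) {h : ℝ} (hh : 0 < h) :
    Tendsto (fbmIncrCov H h) atTop (𝓝 0) := by
  have hslope : ∀ u > h, ∃ v, u - h < v ∧
      fbmIncrCov H h u = h ^ 2 * (2 * H * (2 * H - 1)) / 2 * v ^ (2 * H - 2) := by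
    intro u hu
    have hd : ∀ (p x : ℝ), 0 < x → HasDerivAt (fun x : ℝ => x ^ p) (p * x ^ (p - 1)) x :=
      fun p x hx => Real.hasDerivAt_rpow_const (Or.inl hx.ne')
    have hd₁ : ∀ x ∈ Set.Icc (u - h) u, HasDerivAt (fun x : ℝ => (x + h) ^ (2 * H) - x ^ (2 * H))
        (2 * H * (x + h) ^ (2 * H - 1) - 2 * H * x ^ (2 * H - 1)) x := fun x hx => by
      have hx0 : 0 < x := by linarith [hx.1]
      exact ((hd (2 * H) (x + h) (by linarith)).comp_add_const x h).sub (hd (2 * H) x hx0)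
    obtain ⟨ξ, hξ, hξeq⟩ := exists_hasDerivAt_eq_slope _ _ (by linarith : u - h < u)
      (fun x hx => (hd₁ x hx).continuousAt.continuousWithinAt)
      fun x hx => hd₁ x (Set.Ioo_subset_Icc_self hx)
    have hd₂ : ∀ x ∈ Set.Icc ξ (ξ + h), HasDerivAt (fun x : ℝ => x ^ (2 * H - 1))
        ((2 * H - 1) * x ^ (2 * H - 1 - 1)) x := fun x hx =>
      hd _ x (by linarith [hx.1, hξ.1])
    obtain ⟨v, hv, hveq⟩ := exists_hasDerivAt_eq_slope _ _ (by linarith : ξ < ξ + h)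
      (fun x hx => (hd₂ x hx).continuousAt.continuousWithinAt)
      fun x hx => hd₂ x (Set.Ioo_subset_Icc_self hx)
    refine ⟨v, by linarith [hξ.1, hv.1], ?_⟩
    rw [eq_div_iff (by linarith)] at hξeq hveq
    rw [fbmIncrCov, abs_of_pos (by linarith), abs_of_pos (by linarith), abs_of_pos (by linarith)]
    rw [show 2 * H - 2 = 2 * H - 1 - 1 by ring]
    rw [sub_add_cancel] at hξeq
    have e₁ : u - (u - h) = h := by ring
    have e₂ : ξ + h - ξ = h := by ring
    rw [e₁] at hξeq
    rw [e₂] at hveq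
    linear_combination (-1 / 2) * hξeq - H * h * hveq
  have hrpow : Tendsto (fun u : ℝ => |h ^ 2 * (2 * H * (2 * H - 1)) / 2| * (u - h) ^ (2 * H - 2))
      atTop (𝓝 0) := by
    have h1 := (tendsto_rpow_neg_atTop (by linarith : 0 < 2 - 2 * H)).comp
      (tendsto_atTop_add_const_right atTop (-h) tendsto_id)
    have h2 := h1.const_mul |h ^ 2 * (2 * H * (2 * H - 1)) / 2|
    rw [mul_zero] at h2
    refine h2.congr fun u => ?_
    simp [sub_eq_add_neg]
  refine squeeze_zero_norm' ?_ hrpow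
  filter_upwards [eventually_gt_atTop h] with u hu
  obtain ⟨v, hv, heq⟩ := hslope u hu
  have hv0 : 0 < u - h := by linarith
  rw [heq, norm_mul, Real.norm_eq_abs, Real.norm_eq_abs, abs_of_nonneg (a := v ^ (2 * H - 2))
    (Real.rpow_nonneg (by linarith) _)]
  exact mul_le_mul_of_nonneg_left (Real.rpow_le_rpow_of_nonpos hv0 hv.le (by linarith))
    (abs_nonneg _)

/-- The Riemann sum with `n` nodes approximating the increment of the normalized integral of `W`
from the `k`-th to the next window of length `h`. -/
def riemannIncr (W : ℝ → Ω → ℝ) (h : ℝ) (n k : ℕ) (ω : Ω) : ℝ :=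
  (1 / (n : ℝ)) * ∑ i ∈ Finset.range n,
    (W (k * h + i / n * h + h) ω - W (k * h + i / n * h) ω)

omit [MeasurableSpace Ω] in
lemma riemannIncr_mem (W : ℝ → Ω → ℝ) {h : ℝ} (hh : 0 ≤ h) (n k : ℕ) :
    riemannIncr W h n k ∈ processSpan W := by
  have : riemannIncr W h n k = (1 / (n : ℝ)) • ∑ i ∈ Finset.range n,
      (W (k * h + i / n * h + h) - W (k * h + i / n * h)) := by
    ext ω; simp [riemannIncr]
  rw [this]
  exact Submodule.smul_mem _ _ (Submodule.sum_mem _ fun i _ =>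
    Submodule.sub_mem _ (mem_processSpan W (by positivity)) (mem_processSpan W (by positivity)))

lemma IsFBM.integral_riemannIncr_mul (hW : IsFBM P H W) {h : ℝ} (hh : 0 ≤ h) (n j k : ℕ) :
    ∫ ω, riemannIncr W h n j ω * riemannIncr W h n k ω ∂P =
      (1 / (n : ℝ)) ^ 2 * ∑ i ∈ Finset.range n, ∑ l ∈ Finset.range n,
        fbmIncrCov H h (((j : ℝ) - k) * h + (i - l) / n * h) := by
  have hnn : ∀ k i : ℕ, 0 ≤ (k : ℝ) * h + i / n * h := fun k i => by positivity
  have hmem : ∀ k i : ℕ, (fun ω => W (k * h + i / n * h + h) ω - W (k * h + i / n * h) ω) ∈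
      processSpan W := fun k i => Submodule.sub_mem _
    (mem_processSpan W (add_nonneg (hnn k i) hh)) (mem_processSpan W (hnn k i))
  have hi := fun i l => hW.isGaussianSpace.integrable_mul (hmem j i) (hmem k l)
  calc _ = ∫ ω, (1 / (n : ℝ)) ^ 2 * ∑ i ∈ Finset.range n, ∑ l ∈ Finset.range n,
          (W (j * h + i / n * h + h) ω - W (j * h + i / n * h) ω) *
            (W (k * h + l / n * h + h) ω - W (k * h + l / n * h) ω) ∂P := by
        congr 1; ext ω
        rw [riemannIncr, riemannIncr, mul_mul_mul_comm, Finset.sum_mul_sum, sq]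
    _ = _ := by
        rw [integral_const_mul,
          integral_finsetSum _ fun i _ => integrable_finsetSum _ fun l _ => hi i l]
        congr 1
        refine Finset.sum_congr rfl fun i _ => ?_
        rw [integral_finsetSum _ fun l _ => hi i l]
        refine Finset.sum_congr rfl fun l _ => ?_
        rw [hW.integral_incr_mul_incr hh (hnn j i) (hnn k l)]
        congr 1
        ring

lemma IsFBM.integral_riemannIncr_succ_mul_succ (hW : IsFBM P H W) {h : ℝ} (hh : 0 ≤ h)
    (n j k : ℕ) :
    ∫ ω, riemannIncr W h n (j + 1) ω * riemannIncr W h n (k + 1) ω ∂P =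
      ∫ ω, riemannIncr W h n j ω * riemannIncr W h n k ω ∂P := by
  rw [hW.integral_riemannIncr_mul hh, hW.integral_riemannIncr_mul hh]
  push_cast
  simp_rw [add_sub_add_right_eq_sub]

lemma IsFBM.exists_abs_integral_riemannIncr_le (hW : IsFBM P H W) (hH : H < 1) {h : ℝ} (hh : 0 < h)
    {ε : ℝ} (hε : 0 < ε) : ∃ K, ∀ n j k, j + K ≤ k →
      |∫ ω, riemannIncr W h n k ω * riemannIncr W h n j ω ∂P| ≤ ε := by
  obtain ⟨M, hM⟩ := eventually_atTop.1 (Metric.tendsto_nhds.1 (tendsto_fbmIncrCov_atTop hH hh) ε hε)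
  obtain ⟨K, hK⟩ := exists_nat_ge (M / h + 1)
  refine ⟨K, fun n j k hjk => ?_⟩
  rw [hW.integral_riemannIncr_mul hh.le]
  rcases Nat.eq_zero_or_pos n with rfl | hn
  · simpa using hε.le
  have hn' : (0 : ℝ) < n := by exact_mod_cast hn
  have hbound : ∀ i ∈ Finset.range n, ∀ l ∈ Finset.range n,
      |fbmIncrCov H h (((k : ℝ) - j) * h + ((i : ℝ) - l) / n * h)| ≤ ε := by
    intro i _ l hl
    have h1 : (K : ℝ) ≤ k - j := by
      have : ((j + K : ℕ) : ℝ) ≤ k := by exact_mod_cast hjk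
      push_cast at this
      linarith
    have h2 : -1 ≤ ((i : ℝ) - l) / n := by
      rw [le_div_iff₀ hn']
      have : (l : ℝ) ≤ n := by exact_mod_cast (Finset.mem_range.1 hl).le
      have : (0 : ℝ) ≤ i := by positivity
      linarith
    have h3 : M ≤ ((k : ℝ) - j) * h + ((i : ℝ) - l) / n * h := by
      rw [← add_mul, ← div_le_iff₀ hh]
      linarith
    simpa using (hM _ h3).le
  calc _ ≤ (1 / (n : ℝ)) ^ 2 * ∑ i ∈ Finset.range n, ∑ l ∈ Finset.range n, ε := by
        rw [abs_mul, abs_of_nonneg (by positivity : 0 ≤ (1 / (n : ℝ)) ^ 2)]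
        gcongr
        refine (Finset.abs_sum_le_sum_abs _ _).trans (Finset.sum_le_sum fun i hi => ?_)
        exact (Finset.abs_sum_le_sum_abs _ _).trans (Finset.sum_le_sum fun l hl => hbound i hi l hl)
    _ = ε := by
        simp only [Finset.sum_const, Finset.card_range, nsmul_eq_mul]
        field_simp

/-- Left Riemann sums of a continuous function converge to its mean. -/
lemma tendsto_riemannSum {f : ℝ → ℝ} (hf : Continuous f) (t : ℝ) {h : ℝ} (hh : 0 < h) :
    Tendsto (fun n : ℕ => (1 / (n : ℝ)) * ∑ i ∈ Finset.range n, f (t + i / n * h)) atTop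
      (𝓝 ((1 / h) * ∫ u in t..(t + h), f u)) := by
  refine Metric.tendsto_atTop'.2 fun ε hε => ?_
  obtain ⟨δ, hδ, hδf⟩ := Metric.uniformContinuousOn_iff.1
    (isCompact_Icc (a := t) (b := t + h) |>.uniformContinuousOn_of_continuous hf.continuousOn)
    (ε / 2) (by positivity)
  obtain ⟨N, hN⟩ := exists_nat_gt (h / δ)
  refine ⟨N, fun n hn => ?_⟩
  have hn0 : (0 : ℝ) < n := by
    have : 0 < n := by omega
    exact_mod_cast this
  have hstep : h / n < δ := by
    have : (N : ℝ) < n := by exact_mod_cast hn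
    rw [div_lt_comm₀ hn0 hδ]
    exact hN.trans this
  set x : ℕ → ℝ := fun i => t + i / n * h with hx
  have hx_succ : ∀ i, x (i + 1) - x i = h / n := fun i => by simp only [hx]; push_cast; ring
  have hsplit : ∫ u in t..(t + h), f u = ∑ i ∈ Finset.range n, ∫ u in x i..x (i + 1), f u := by
    rw [intervalIntegral.sum_integral_adjacent_intervals fun i _ => hf.intervalIntegrable _ _]
    congr 1
    · simp [hx]
    · simp [hx, hn0.ne']
  have hterm : ∀ i ∈ Finset.range n,
      |h / n * f (x i) - ∫ u in x i..x (i + 1), f u| ≤ h / n * (ε / 2) := by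
    intro i hi
    have hle : x i ≤ x (i + 1) := by
      have : 0 < h / n := by positivity
      linarith [hx_succ i]
    have hconst : h / n * f (x i) = ∫ _ in x i..x (i + 1), f (x i) := by
      rw [intervalIntegral.integral_const, hx_succ, smul_eq_mul]
    rw [hconst, ← intervalIntegral.integral_sub intervalIntegrable_const
      (hf.intervalIntegrable _ _)]
    have hlow : t ≤ x i := by
      have : 0 ≤ (i : ℝ) / n * h := by positivity
      simp only [hx]; linarith
    have hhigh : x (i + 1) ≤ t + h := by
      have h1 : ((i + 1 : ℕ) : ℝ) ≤ n := by exact_mod_cast Finset.mem_range.1 hi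
      have h2 : ((i + 1 : ℕ) : ℝ) / n ≤ 1 := (div_le_one hn0).2 h1
      simp only [hx]
      nlinarith
    have := intervalIntegral.norm_integral_le_of_norm_le_const (a := x i) (b := x (i + 1))
      (f := fun u => f (x i) - f u) (C := ε / 2) fun u hu => by
        rw [Set.uIoc_of_le hle] at hu
        have := hδf (x i) ⟨hlow, hle.trans hhigh⟩ u ⟨hlow.trans hu.1.le, hu.2.trans hhigh⟩ (by
          rw [Real.dist_eq, abs_sub_comm, abs_of_pos (by linarith [hu.1])]
          linarith [hx_succ i, hu.2])
        exact this.le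
    rw [hx_succ, abs_of_pos (by positivity : 0 < h / n), Real.norm_eq_abs] at this
    linarith
  have hsum : |∑ i ∈ Finset.range n, (h / n * f (x i) - ∫ u in x i..x (i + 1), f u)| ≤
      h * (ε / 2) := by
    refine (Finset.abs_sum_le_sum_abs _ _).trans ((Finset.sum_le_sum hterm).trans ?_)
    rw [Finset.sum_const, Finset.card_range, nsmul_eq_mul]
    apply le_of_eq
    field_simp
  have hdiff : (1 / (n : ℝ)) * ∑ i ∈ Finset.range n, f (x i) - (1 / h) * ∫ u in t..(t + h), f u =
      (1 / h) * ∑ i ∈ Finset.range n, (h / n * f (x i) - ∫ u in x i..x (i + 1), f u) := by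
    rw [Finset.sum_sub_distrib, ← hsplit, ← Finset.mul_sum]
    field_simp
  rw [Real.dist_eq, hdiff, abs_mul, abs_of_pos (by positivity : 0 < 1 / h)]
  calc _ ≤ 1 / h * (h * (ε / 2)) := by gcongr
    _ = ε / 2 := by field_simp
    _ < ε := by linarith

omit [MeasurableSpace Ω] in
lemma tendsto_riemannIncr {h : ℝ} (hh : 0 < h) {ω : Ω} (hω : Continuous fun t => W t ω) (k : ℕ) :
    Tendsto (fun n => riemannIncr W h n k ω) atTop
      (𝓝 (nifBm W h (((k + 1 : ℕ) : ℝ) * h) ω - nifBm W h ((k : ℝ) * h) ω)) := by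
  have h1 := tendsto_riemannSum hω (((k + 1 : ℕ) : ℝ) * h) hh
  have h2 := tendsto_riemannSum hω ((k : ℝ) * h) hh
  refine (h1.sub h2).congr fun n => ?_
  rw [← mul_sub, ← Finset.sum_sub_distrib, riemannIncr]
  congr 1
  refine Finset.sum_congr rfl fun i _ => ?_
  congr 2
  push_cast
  ring

lemma IsFBM.measurable_nifBm (hW : IsFBM P H W) (h t : ℝ) : Measurable (nifBm W h t) := by
  unfold nifBm intervalIntegral
  have hm : ∀ s : Set ℝ, Measurable fun ω => ∫ u in s, W u ω := fun s =>
    (hW.jointMeasurable.stronglyMeasurable.integral_prod_left (μ := volume.restrict s)).measurable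
  exact ((hm _).sub (hm _)).const_mul _

end FractionalBrownianMotion

/-- Ergodic theorem for `{ΔX̃_k^h}`: for any Borel `Q : ℝ → ℝ` with
`E|Q(ΔX̃_0^h)| < ∞`, `(1/N) ∑_{k=0}^{N-1} Q(ΔX̃_k^h) → E[Q(ΔX̃_0^h)]` a.s. -/
theorem dtX_ergodic
    (P : Measure Ω) [IsProbabilityMeasure P]
    (H₁ H₂ : ℝ) (hH₁ : H₁ ∈ Set.Ioo (0:ℝ) 1) (hH₂ : H₂ ∈ Set.Ioo (0:ℝ) 1)
    (W₁ W₂ : ℝ → Ω → ℝ) (hW₁ : IsFBM P H₁ W₁) (hW₂ : IsFBM P H₂ W₂)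
    (hIndep : IndepFun (fun ω t => W₁ t ω) (fun ω t => W₂ t ω) P)
    (a b : ℝ) (ha : a ≠ 0) (hb : b ≠ 0) (h : ℝ) (hh : 0 < h)
    (Q : ℝ → ℝ) (hQ : Measurable Q)
    (hint : Integrable (fun ω => Q (dtX W₁ W₂ a b h 0 ω)) P) :
    ∀ᵐ ω ∂P, Tendsto
      (fun N : ℕ => (1/(N:ℝ)) * ∑ k ∈ Finset.range N, Q (dtX W₁ W₂ a b h k ω))
      atTop (𝓝 (∫ ω, Q (dtX W₁ W₂ a b h 0 ω) ∂P)) := by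
  have hV₁ := hW₁.isGaussianSpace
  have hV₂ := hW₂.isGaussianSpace
  have hD₁ := riemannIncr_mem W₁ hh.le
  have hD₂ := riemannIncr_mem W₂ hh.le
  have hcov : ∀ n j k, ∫ ω, (a * riemannIncr W₁ h n j ω + b * riemannIncr W₂ h n j ω) *
      (a * riemannIncr W₁ h n k ω + b * riemannIncr W₂ h n k ω) ∂P =
      a ^ 2 * ∫ ω, riemannIncr W₁ h n j ω * riemannIncr W₁ h n k ω ∂P +
        b ^ 2 * ∫ ω, riemannIncr W₂ h n j ω * riemannIncr W₂ h n k ω ∂P := by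
    intro n j k
    have i₁ := hV₁.integrable_mul (hD₁ n j) (hD₁ n k)
    have i₂ := hV₂.integrable_mul (hD₂ n j) (hD₂ n k)
    have hcross : ∀ j k, Integrable (fun ω => riemannIncr W₁ h n j ω * riemannIncr W₂ h n k ω) P ∧
        ∫ ω, riemannIncr W₁ h n j ω * riemannIncr W₂ h n k ω ∂P = 0 := fun j k => by
      refine ⟨(hV₁.memLp (hD₁ n j)).integrable_mul (hV₂.memLp (hD₂ n k)), ?_⟩
      have := (indepFun_of_mem_processSpan hIndep (hD₁ n j) (hD₂ n k)).integral_mul_eq_mul_integral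
        (hV₁.aemeasurable (hD₁ n j)).aestronglyMeasurable
        (hV₂.aemeasurable (hD₂ n k)).aestronglyMeasurable
      rw [hV₁.integral_eq_zero (hD₁ n j), zero_mul] at this
      exact this
    have i₃ : Integrable (fun ω => a ^ 2 * (riemannIncr W₁ h n j ω * riemannIncr W₁ h n k ω) +
        b ^ 2 * (riemannIncr W₂ h n j ω * riemannIncr W₂ h n k ω)) P :=
      (i₁.const_mul _).add (i₂.const_mul _)
    have i₄ : Integrable (fun ω => riemannIncr W₁ h n j ω * riemannIncr W₂ h n k ω +
        riemannIncr W₁ h n k ω * riemannIncr W₂ h n j ω) P := (hcross j k).1.add (hcross k j).1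
    calc _ = ∫ ω, (a ^ 2 * (riemannIncr W₁ h n j ω * riemannIncr W₁ h n k ω) +
            b ^ 2 * (riemannIncr W₂ h n j ω * riemannIncr W₂ h n k ω) +
            a * b * (riemannIncr W₁ h n j ω * riemannIncr W₂ h n k ω +
              riemannIncr W₁ h n k ω * riemannIncr W₂ h n j ω)) ∂P := by
          congr 1; ext ω; ring
      _ = _ := by
          rw [integral_add i₃ (i₄.const_mul _),
            integral_add (i₁.const_mul _) (i₂.const_mul _), integral_const_mul, integral_const_mul,
            integral_const_mul, integral_add (hcross j k).1 (hcross k j).1, (hcross j k).2,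
            (hcross k j).2]
          ring
  refine (isGaussianSpace_sup hV₁ hV₂ hIndep).ae_tendsto_average
    (Z := fun n k ω => a * riemannIncr W₁ h n k ω + b * riemannIncr W₂ h n k ω)
    (fun n k => ?_) (fun k => ?_) ?_ (fun n j k => ?_) (fun ε hε => ?_) hQ hint
  · exact Submodule.add_mem_sup (Submodule.smul_mem _ a (hD₁ n k))
      (Submodule.smul_mem _ b (hD₂ n k))
  · have hm : ∀ k : ℕ, Measurable (tX W₁ W₂ a b h k) := fun k =>
      ((hW₁.measurable_nifBm h _).const_mul a).add ((hW₂.measurable_nifBm h _).const_mul b)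
    exact (hm (k + 1)).sub (hm k)
  · filter_upwards [hW₁.cont, hW₂.cont] with ω h₁ h₂ k
    have := ((tendsto_riemannIncr hh h₁ k).const_mul a).add
      ((tendsto_riemannIncr hh h₂ k).const_mul b)
    convert this using 2
    rw [dtX, tX, tX]
    ring
  · rw [hcov, hcov, hW₁.integral_riemannIncr_succ_mul_succ hh.le,
      hW₂.integral_riemannIncr_succ_mul_succ hh.le]
  · have hc : 0 < a ^ 2 + b ^ 2 := by positivity
    obtain ⟨K₁, hK₁⟩ := hW₁.exists_abs_integral_riemannIncr_le hH₁.2 hh (div_pos hε hc)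
    obtain ⟨K₂, hK₂⟩ := hW₂.exists_abs_integral_riemannIncr_le hH₂.2 hh (div_pos hε hc)
    refine ⟨max K₁ K₂, fun n j k hjk => ?_⟩
    rw [hcov]
    calc _ ≤ a ^ 2 * (ε / (a ^ 2 + b ^ 2)) + b ^ 2 * (ε / (a ^ 2 + b ^ 2)) := by
          refine (abs_add_le _ _).trans ?_
          rw [abs_mul, abs_mul, abs_of_nonneg (sq_nonneg a), abs_of_nonneg (sq_nonneg b)]
          exact add_le_add
            (mul_le_mul_of_nonneg_left (hK₁ n j k (by omega)) (sq_nonneg a))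
            (mul_le_mul_of_nonneg_left (hK₂ n j k (by omega)) (sq_nonneg b))
      _ = ε := by field_simp
end
end
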